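/- For every rc-graph R satisfying condition (*) and all integers 0 < x ≤ y < z ≤ n, one has R ← xzy = R ← zxy; that is, inserting x, then z, then y produces the same rc-graph as inserting z, then x, then y. -/

import Mathlib

open scoped Classical

noncomputable section

namespace RCGraphs

/-- The simple transposition `s j`, interchanging `j` and `j+1`. -/
def sT (j : ℤ) : Equiv.Perm ℤ := Equiv.swap j (j + 1)

/-- The Coxeter length of a permutation of `ℤ`: the minimal length of an expression
as a product of simple transpositions. -/
def len (w : Equiv.Perm ℤ) : ℕ :=
  sInf {m : ℕ | ∃ l : List ℤ, l.length = m ∧ (l.map sT).prod = w}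

/-- The permutations considered in the paper: bijections of `ℤ` fixing every `i > n`
and fixing all sufficiently small integers. -/
def IsPermZ (n : ℤ) (w : Equiv.Perm ℤ) : Prop :=
  (∀ i : ℤ, n < i → w i = i) ∧ ∃ N : ℤ, ∀ i : ℤ, i < N → w i = i

/-- The reading order on positions `(i,k)`: rows (second coordinate) from `n` downward,
and within a row in order of increasing first coordinate. -/
def rcOrder (p q : ℤ × ℤ) : Prop :=
  q.2 < p.2 ∨ (p.2 = q.2 ∧ p.1 ≤ q.1)

instance : DecidableRel rcOrder := fun p q => by
  unfold rcOrder; infer_instance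

instance : IsTrans (ℤ × ℤ) rcOrder :=
  ⟨fun a b c h₁ h₂ => by unfold rcOrder at *; omega⟩

instance : IsAntisymm (ℤ × ℤ) rcOrder :=
  ⟨fun a b h₁ h₂ => by
    unfold rcOrder at *
    have h3 : a.1 = b.1 ∧ a.2 = b.2 := by omega
    exact Prod.ext h3.1 h3.2⟩

instance : IsTotal (ℤ × ℤ) rcOrder :=
  ⟨fun a b => by unfold rcOrder; omega⟩

/-- The permutation `w_R` associated to a finite set of positions `R`: the product of the
simple transpositions `s_{i+k-n-1}`, `(i,k) ∈ R`, in the reading order. -/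
def wR (n : ℤ) (R : Finset (ℤ × ℤ)) : Equiv.Perm ℤ :=
  ((R.sort rcOrder).map fun p => sT (p.1 + p.2 - n - 1)).prod

/-- `R` is an rc-graph: positions lie in the grid `{(i,k) : i ≤ n, k ≤ n}` and the
reading word is reduced. -/
def IsRC (n : ℤ) (R : Finset (ℤ × ℤ)) : Prop :=
  (∀ p ∈ R, p.1 ≤ n ∧ p.2 ≤ n) ∧ len (wR n R) = R.card

/-- Condition (*): `w_R(i) > w_R(i-1)` for all `i ≤ 0`; equivalently no two strands with
nonpositive labels cross. -/
def Star (n : ℤ) (R : Finset (ℤ × ℤ)) : Prop :=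
  ∀ i : ℤ, i ≤ 0 → wR n R (i - 1) < wR n R i

/-- Strand labels in the wiring diagram of `R` (for diagrams all of whose crossings lie in
rows `k ≥ 1`, as is the case under condition (*)).  `lab n R true i k` is the label of the
strand entering position `(i,k)` from the west (the strand passing above, if `(i,k)` is not
a crossing); `lab n R false i k` is the label of the strand entering from the south (the
strand passing below).  Each strand is labeled by the row where it begins. -/
def lab (n : ℤ) (R : Finset (ℤ × ℤ)) : Bool → ℤ → ℤ → ℤ
  | true, i, k =>
      if h : n ≤ i then k
      else if (i + 1, k) ∈ R then lab n R true (i + 1) k else lab n R false (i + 1) k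
  | false, i, k =>
      if h : k ≤ 0 then i + k - n - 1
      else if (i, k - 1) ∈ R then lab n R false i (k - 1) else lab n R true i (k - 1)
  termination_by b i k => ((n - i).toNat + k.toNat)
  decreasing_by
    all_goals simp_wf
    all_goals omega

/-- The label of the strand leaving position `(i,r)` northward. -/
def northLabel (n : ℤ) (R : Finset (ℤ × ℤ)) (i r : ℤ) : ℤ :=
  if (i, r) ∈ R then lab n R false i r else lab n R true i r

/-- `(i,k)` is an open space: not a crossing, the strand passing below it has a
nonpositive label and the strand passing above it has a positive label. -/
def OpenSpace (n : ℤ) (R : Finset (ℤ × ℤ)) (i k : ℤ) : Prop :=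
  i ≤ n ∧ (i, k) ∉ R ∧ lab n R false i k ≤ 0 ∧ 0 < lab n R true i k

/-- The main loop of the Bergeron--Billey insertion algorithm, recording the trace:
the list of pairs (current diagram, crossing just added).  `R` always contains the
crossing `p` that was just added. -/
def insertSteps (n : ℤ) : ℕ → Finset (ℤ × ℤ) → ℤ × ℤ → List (Finset (ℤ × ℤ) × (ℤ × ℤ))
  | 0, _, _ => []
  | fuel + 1, R, p =>
      (R, p) ::
        if IsRC n R then []
        else
          let a := lab n R true p.1 p.2
          let b := lab n R false p.1 p.2
          -- the unique other crossing of the two strands that cross at `p`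
          let C := R.filter fun q =>
            q ≠ p ∧ ((lab n R true q.1 q.2 = a ∧ lab n R false q.1 q.2 = b) ∨
                     (lab n R true q.1 q.2 = b ∧ lab n R false q.1 q.2 = a))
          let q := (C.sort rcOrder).headI
          let R' := R.erase q
          let i' := sInf {x : ℤ | q.1 < x ∧ OpenSpace n R' x q.2}
          insertSteps n fuel (insert (i', q.2) R') (i', q.2)

/-- The trace of the insertion of `k` into `R`: the states of the algorithm together with
the crossings added at each step. -/
def insertStepsOf (n : ℤ) (R : Finset (ℤ × ℤ)) (k : ℤ) : List (Finset (ℤ × ℤ) × (ℤ × ℤ)) :=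
  let i₁ := sInf {x : ℤ | OpenSpace n R x k}
  insertSteps n ((n + 1 - k).toNat + 1) (insert (i₁, k) R) (i₁, k)

/-- The insertion `R ← k` of Bergeron and Billey. -/
def insertOne (n : ℤ) (R : Finset (ℤ × ℤ)) (k : ℤ) : Finset (ℤ × ℤ) :=
  ((insertStepsOf n R k).getLast?.getD (R, (0, 0))).1

/-- The insertion `R ← v` of a word. -/
def insertWord (n : ℤ) (R : Finset (ℤ × ℤ)) (v : List ℕ) : Finset (ℤ × ℤ) :=
  v.foldl (fun S a => insertOne n S (a : ℤ)) R

/-- The column (first coordinate) at which the strand labeled `a` of the diagram `R`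
leaves row `r` northward. -/
def strandCol (n : ℤ) (R : Finset (ℤ × ℤ)) (a r : ℤ) : ℤ :=
  sSup {i : ℤ | i ≤ n ∧ northLabel n R i r = a}

/-- Given the trace `L` of an insertion, the column occupied in row `r` by the left path
(`left = true`) or the right path (`left = false`) of the insertion.  Between the rows of
the `t`-th and `(t+1)`-st added crossings, the left path is the piece `s_t` of the strand
whose label changes from `a_t` to `b_t`, and the right path is the piece `s^t` whose label
changes from `b_t` to `a_t`. -/
def pathCol (n : ℤ) (L : List (Finset (ℤ × ℤ) × (ℤ × ℤ))) (left : Bool) (r : ℤ) : ℤ :=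
  match (L.filter fun e => e.2.2 ≤ r).getLast? with
  | some e => strandCol n e.1 (lab n e.1 left e.2.1 e.2.2) r
  | none => 0

/-- A semistandard Young tableau with at most `n` rows (rows indexed `1,…,n`, row `j`
having `μ j` boxes, columns indexed from `0`), with entries in `{1,…,n}`, weakly
increasing along rows and strictly increasing down columns; entries outside the shape
are `0`. -/
structure SSYT (n : ℕ) (μ : ℕ → ℕ) where
  entry : ℕ → ℕ → ℕ
  entry_mem : ∀ j c, 1 ≤ j → j ≤ n → c < μ j → 1 ≤ entry j c ∧ entry j c ≤ n
  row_weak : ∀ j c₁ c₂, 1 ≤ j → j ≤ n → c₁ ≤ c₂ → c₂ < μ j → entry j c₁ ≤ entry j c₂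
  col_strict : ∀ j₁ j₂ c, 1 ≤ j₁ → j₁ < j₂ → j₂ ≤ n → c < μ j₂ → entry j₁ c < entry j₂ c
  outside : ∀ j c, j = 0 ∨ n < j ∨ μ j ≤ c → entry j c = 0

/-- `μ` is a partition with (at most) `n` parts `μ 1 ≥ μ 2 ≥ … ≥ μ n ≥ 0`
(and `μ j = 0` outside `1,…,n`). -/
def IsPartition (n : ℕ) (μ : ℕ → ℕ) : Prop :=
  (∀ j, 1 ≤ j → j < n → μ (j + 1) ≤ μ j) ∧ ∀ j, j = 0 ∨ n < j → μ j = 0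

/-- The reading word of a tableau: the rows read left to right, from the bottom row
to the top one. -/
def readingWord (n : ℕ) (μ : ℕ → ℕ) (Y : SSYT n μ) : List ℕ :=
  ((List.range n).reverse.map (· + 1)).flatMap fun j =>
    (List.range (μ j)).map fun c => Y.entry j c

/-- An elementary Knuth move. -/
def KnuthMove (w₁ w₂ : List ℕ) : Prop :=
  (∃ (u v : List ℕ) (x y z : ℕ), x < y ∧ y ≤ z ∧
      w₁ = u ++ y :: x :: z :: v ∧ w₂ = u ++ y :: z :: x :: v) ∨
  (∃ (u v : List ℕ) (x y z : ℕ), x ≤ y ∧ y < z ∧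
      w₁ = u ++ x :: z :: y :: v ∧ w₂ = u ++ z :: x :: y :: v)

/-- Knuth equivalence: the equivalence relation generated by elementary Knuth moves. -/
def KnuthEquiv (w₁ w₂ : List ℕ) : Prop := Relation.EqvGen KnuthMove w₁ w₂

/-- The monomial `x^R = ∏_{(i,k) ∈ R} x_k`. -/
def xR (R : Finset (ℤ × ℤ)) : MvPolynomial ℕ ℤ :=
  ∏ p ∈ R, MvPolynomial.X p.2.toNat

/-- The monomial `x^Y = ∏ x_i`, one factor for each entry `i` of `Y`. -/
def xY (n : ℕ) (μ : ℕ → ℕ) (Y : SSYT n μ) : MvPolynomial ℕ ℤ :=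
  ((readingWord n μ Y).map MvPolynomial.X).prod

/-- The Schubert polynomial `S_w = Σ_{R : w_R = w} x^R`. -/
def Schub (n : ℤ) (w : Equiv.Perm ℤ) : MvPolynomial ℕ ℤ :=
  ∑ᶠ R ∈ {R : Finset (ℤ × ℤ) | IsRC n R ∧ wR n R = w}, xR R

/-- The Schur polynomial `s_μ(x₁,…,x_n) = Σ_Y x^Y`, summing over all semistandard Young
tableaux of shape `μ` with entries in `{1,…,n}`. -/
def SchurP (n : ℕ) (μ : ℕ → ℕ) : MvPolynomial ℕ ℤ :=
  ∑ᶠ Y : SSYT n μ, xY n μ Y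

/-- The complete homogeneous symmetric polynomial
`h_m = Σ_{1 ≤ i₁ ≤ … ≤ i_m ≤ n} x_{i₁} ⋯ x_{i_m}`. -/
def hPoly (n m : ℕ) : MvPolynomial ℕ ℤ :=
  ∑ s ∈ (Finset.Icc 1 n).sym m, (s.1.map MvPolynomial.X).prod

/-- The top rc-graph `R(μ) = {(i,k) : 1 ≤ k ≤ n, n - μ_k + 1 ≤ i ≤ n}` of a partition. -/
def Rmu (n : ℕ) (μ : ℕ → ℕ) : Finset (ℤ × ℤ) :=
  (Finset.Icc 1 (n : ℤ)).biUnion fun k =>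
    (Finset.Icc ((n : ℤ) - μ k.toNat + 1) (n : ℤ)).image fun i => (i, k)



/-- the action of the simple transposition `s_j` on positions -/
def sj (j t : ℤ) : ℤ := if t = j then j + 1 else if t = j + 1 then j else t

/-- exchange of positions `j`, `j+1` in a word -/
def swW (W : ℤ → ℤ) (j : ℤ) : ℤ → ℤ := fun t => W (sj j t)

/-- exchange of positions `P`, `Q` in a word -/
def mvW (W : ℤ → ℤ) (P Q : ℤ) : ℤ → ℤ := fun t => W (if t = P then Q else if t = Q then P else t)

def Up (W : ℤ → ℤ) (j : ℤ) : Prop := W j < W (j + 1) ∧ 0 < W (j + 1)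

def Cov (W : ℤ → ℤ) (P Q : ℤ) : Prop :=
  Q < P ∧ 0 < W P ∧ W Q ≤ 0 ∧ ∀ t, Q < t → t < P → W P < W t

def LL (W : ℤ → ℤ) (l r : ℤ) : Prop := l < r ∧ 0 < W r ∧ ∀ t, l < t → t < r → W t ≤ 0

def Step (W : ℤ → ℤ) (j P Q j' P' Q' : ℤ) : Prop :=
  (¬ (Q = j ∧ P = j + 1) ∧ j' = j ∧ P' = sj j P ∧ Q' = sj j Q) ∨
  (Q = j ∧ P = j + 1 ∧ LL W (j + 1) P' ∧ Q' = P' - 1 ∧ j' = P' - 1)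

theorem LL_unique {W : ℤ → ℤ} {l r r' : ℤ} (h : LL W l r) (h' : LL W l r') : r = r' := by
  obtain ⟨h1, h2, h3⟩ := h
  obtain ⟨h1', h2', h3'⟩ := h'
  by_contra hne
  rcases lt_or_gt_of_ne hne with hlt | hlt
  · have := h3' r h1 hlt; omega
  · have := h3 r' h1' hlt; omega

theorem LL_congr {W V : ℤ → ℤ} {l r : ℤ} (h : LL W l r) (hV : ∀ t, l < t → t ≤ r → V t = W t) :
    LL V l r := by
  obtain ⟨h1, h2, h3⟩ := h
  refine ⟨h1, by rw [hV r h1 le_rfl]; exact h2, fun t ht ht' => ?_⟩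
  rw [hV t ht ht'.le]; exact h3 t ht ht'

theorem step_single {W : ℤ → ℤ} {j P Q j' P' Q' : ℤ} (hC : Cov W P Q) (hU : Up W j)
    (hS : Step W j P Q j' P' Q') :
    Cov (swW W j) P' Q' ∧ Up (mvW W P Q) j' ∧ mvW (swW W j) P' Q' = swW (mvW W P Q) j' := by
  obtain ⟨hQP, hP, hQ, hb⟩ := hC
  obtain ⟨u1, u2⟩ := hU
  rcases hS with ⟨hn, rfl, rfl, rfl⟩ | ⟨rfl, rfl, ⟨l1, l2, l3⟩, rfl, rfl⟩
  · have c1 := hb j'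
    have c2 := hb (j' + 1)
    refine ⟨⟨?_, ?_, ?_, ?_⟩, ?_, ?_⟩
    · grind [sj]
    · grind [sj, swW]
    · grind [sj, swW]
    · intro t h1 h2
      have c3 := hb t
      grind [sj, swW]
    · grind [Up, mvW]
    · funext t
      simp only [mvW, swW]
      congr 1
      clear hb c1 c2 hP hQ u1 u2
      simp only [sj]
      split_ifs <;> omega
  · refine ⟨⟨by omega, ?_, ?_, ?_⟩, ?_, ?_⟩
    · grind [sj, swW]
    · have := l3 (P' - 1)
      grind [sj, swW]
    · intro t h1 h2; omega
    · have := l3 (P' - 1)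
      grind [Up, mvW]
    · funext t
      grind [mvW, swW, sj]

theorem Step_nc {W : ℤ → ℤ} {j P Q j' P' Q' : ℤ} (hS : Step W j P Q j' P' Q')
    (h : ¬ (Q = j ∧ P = j + 1)) : j' = j ∧ P' = sj j P ∧ Q' = sj j Q := by
  rcases hS with h1 | h1
  · exact h1.2
  · exact absurd ⟨h1.1, h1.2.1⟩ h

theorem Step_c {W : ℤ → ℤ} {j P Q j' P' Q' : ℤ} (hS : Step W j P Q j' P' Q')
    (h : Q = j ∧ P = j + 1) : LL W (j + 1) P' ∧ Q' = P' - 1 ∧ j' = P' - 1 := by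
  rcases hS with h1 | h1
  · exact absurd h h1.1
  · exact h1.2.2

theorem Step_det {W : ℤ → ℤ} {j P Q j' P' Q' j'' P'' Q'' : ℤ} (hS : Step W j P Q j' P' Q')
    (hT : Step W j P Q j'' P'' Q'') : j' = j'' ∧ P' = P'' ∧ Q' = Q'' := by
  by_cases h : Q = j ∧ P = j + 1
  · obtain ⟨a, b, c⟩ := Step_c hS h
    obtain ⟨a', b', c'⟩ := Step_c hT h
    have := LL_unique a a'
    omega
  · obtain ⟨a, b, c⟩ := Step_nc hS h
    obtain ⟨a', b', c'⟩ := Step_nc hT h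
    omega

theorem sj_far {j t : ℤ} (h1 : t ≠ j) (h2 : t ≠ j + 1) : sj j t = t := by
  simp [sj, h1, h2]

def Rel (P1 Q1 P2 Q2 P3 Q3 D1 E1 D2 E2 D3 E3 : ℤ) : Prop :=
  (D1 = P2 ∧ E1 = Q2 ∧ D2 = P1 ∧ E2 = Q1 ∧ D3 = P3 ∧ E3 = Q3 ∧ P2 < Q1 ∧ Q2 < P3 ∧ P3 ≤ Q1) ∨
  (D1 = P1 ∧ E1 = Q1 ∧ D2 = P3 ∧ E2 = Q3 ∧ D3 = P2 ∧ E3 = Q2 ∧ P1 ≤ Q3 ∧ P2 ≤ Q1) ∨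
  (P2 = Q1 ∧ Q3 = Q1 ∧ D1 = P3 ∧ E1 = Q1 ∧ D2 = P1 ∧ E2 = P3 ∧ D3 = P3 ∧ E3 = Q2 ∧
    Q2 < Q1 ∧ Q1 < P3 ∧ P3 < P1)

theorem clash {W : ℤ → ℤ} {P1 Q1 P3 Q3 l r0 r1 j3 P3' Q3' k2 D2 E2 k3 D3 E3 : ℤ}
    (h1 : Cov W P1 Q1) (h3 : Cov (mvW W P1 Q1) P3 Q3) (hl : W l ≤ 0) (hl3 : l < P3)
    (h31 : P3 ≤ Q1) (L0 : LL W l r0) (L1 : LL (mvW W P1 Q1) l r1)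
    (S3 : Step (mvW W P1 Q1) (r1 - 1) P3 Q3 j3 P3' Q3')
    (T2 : Step W (r0 - 1) P1 Q1 k2 D2 E2) (T3 : Step (mvW W P1 Q1) k2 P3 Q3 k3 D3 E3) :
    j3 = k3 ∧ Rel P1 Q1 r1 (r1 - 1) P3' Q3' r0 (r0 - 1) D2 E2 D3 E3 := by
  obtain ⟨hQP, hP, hQ, hb⟩ := h1
  have mQ : mvW W P1 Q1 Q1 = W P1 := by grind [mvW]
  have mP : mvW W P1 Q1 P1 = W Q1 := by grind [mvW]
  have mlo : ∀ t, t < Q1 → mvW W P1 Q1 t = W t := by intro t ht; grind [mvW]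
  have mhi : ∀ t, P1 < t → mvW W P1 Q1 t = W t := by intro t ht; grind [mvW]
  have mmid : ∀ t, Q1 < t → t < P1 → mvW W P1 Q1 t = W t := by intro t ht; grind [mvW]
  generalize mvW W P1 Q1 = W1 at *
  obtain ⟨c1, c2, c3, c4⟩ := h3
  obtain ⟨a1, a2, a3⟩ := L1
  have hr1 : r1 ≤ Q1 := by
    by_contra hh
    have := a3 Q1 (by omega) (by omega)
    omega
  have hl1 : W1 l ≤ 0 := by rw [mlo l (by omega)]; exact hl
  have hP3 : r1 ≤ P3 := by
    by_contra hh
    have := a3 P3 (by omega) (by omega)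
    omega
  have hr1' : W1 (r1 - 1) ≤ 0 := by
    rcases eq_or_lt_of_le (show l ≤ r1 - 1 by omega) with h | h
    · rw [← h]; exact hl1
    · exact a3 _ h (by omega)
  have hQ3 : P3 = r1 → Q3 = r1 - 1 := by
    intro h
    by_contra hh
    have := c4 (r1 - 1) (by omega) (by omega)
    omega
  by_cases hc : r1 = Q1
  · subst hc
    have e3 : P3 = r1 := by omega
    have e3' := hQ3 e3
    subst e3 e3'
    obtain ⟨b1, b2, b3⟩ := Step_c S3 ⟨rfl, by omega⟩
    by_cases hadj : P1 = P3 + 1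
    · subst hadj
      have : LL W l (P3 + 1) := ⟨by omega, hP, fun t t1 t2 => by
        rcases eq_or_lt_of_le (show t ≤ P3 by omega) with h | h
        · rw [h]; exact hQ
        · rw [← mlo t h]; exact a3 t t1 h⟩
      have hr0 := LL_unique L0 this
      subst hr0
      obtain ⟨d1, d2, d3⟩ := Step_c T2 ⟨by omega, by omega⟩
      have hne : D2 ≠ P3 + 1 := by have := d1.1; omega
      have : LL W1 (P3 - 1 + 1) D2 := by
        obtain ⟨z1, z2, z3⟩ := d1
        refine ⟨by omega, by rw [mhi _ (by omega)]; exact z2, fun t t1 t2 => ?_⟩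
        rcases eq_or_lt_of_le (show P3 + 1 ≤ t by omega) with h | h
        · rw [← h, mP]; exact hQ
        · rw [mhi t h]; exact z3 t (by omega) t2
      have hD := LL_unique this b1
      subst hD
      have := d1.1
      obtain ⟨f1, f2, f3⟩ := Step_nc T3 (by omega)
      rw [sj_far (by omega) (by omega)] at f2 f3
      refine ⟨by omega, Or.inr (Or.inl ?_)⟩
      omega
    · have hpos := hb (P3 + 1) (by omega) (by omega)
      have : LL W l (P3 + 1) := ⟨by omega, by omega, fun t t1 t2 => by
        rcases eq_or_lt_of_le (show t ≤ P3 by omega) with h | h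
        · rw [h]; exact hQ
        · rw [← mlo t h]; exact a3 t t1 h⟩
      have hr0 := LL_unique L0 this
      subst hr0
      have : LL W1 (P3 - 1 + 1) (P3 + 1) :=
        ⟨by omega, by rw [mmid _ (by omega) (by omega)]; omega, fun t t1 t2 => by omega⟩
      have hD := LL_unique b1 this
      subst hD
      obtain ⟨f1, f2, f3⟩ := Step_nc T2 (by omega)
      subst f1
      obtain ⟨g1, g2, g3⟩ := Step_nc T3 (by omega)
      refine ⟨by omega, Or.inr (Or.inr ?_)⟩
      grind [sj]
  · have : LL W l r1 := ⟨a1, by rw [← mlo _ (by omega)]; exact a2, fun t t1 t2 => by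
      rw [← mlo _ (by omega)]; exact a3 t t1 t2⟩
    have hr0 := LL_unique L0 this
    subst hr0
    obtain ⟨f1, f2, f3⟩ := Step_nc T2 (by omega)
    rw [sj_far (by omega) (by omega)] at f2 f3
    subst f1
    obtain ⟨g1, g2, g3⟩ := Step_det S3 T3
    refine ⟨g1, Or.inl ?_⟩
    by_cases hcon : Q3 = r0 - 1 ∧ P3 = r0 - 1 + 1
    · obtain ⟨b1, b2, b3⟩ := Step_c S3 hcon
      have : P3' ≤ Q1 := by
        by_contra hh
        have := b1.2.2 Q1 (by omega) (by omega)
        omega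
      have := b1.1
      omega
    · obtain ⟨f1, f2', f3⟩ := Step_nc S3 hcon
      rw [sj_far (by omega) (by omega)] at f2'
      omega


theorem mv_facts (W : ℤ → ℤ) (P Q : ℤ) : mvW W P Q Q = W P ∧ mvW W P Q P = W Q ∧
    ∀ t, t ≠ P → t ≠ Q → mvW W P Q t = W t := by
  refine ⟨?_, ?_, ?_⟩ <;> grind [mvW]

theorem mv_comm (W : ℤ → ℤ) {P Q P' Q' : ℤ} (h1 : P ≠ P') (h2 : P ≠ Q') (h3 : Q ≠ P') (h4 : Q ≠ Q') :
    mvW (mvW W P Q) P' Q' = mvW (mvW W P' Q') P Q := by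
  funext t
  simp only [mvW]
  congr 1
  split_ifs <;> omega

theorem LL_iff {W V : ℤ → ℤ} {l r : ℤ} (h : LL W l r) (hV : ∀ t, l < t → t ≤ r → V t = W t)
    {r' : ℤ} (h' : LL V l r') : r' = r := LL_unique h' (LL_congr h hV)

theorem local_TA {W : ℤ → ℤ} {j P1 Q1 P2 Q2 P3 Q3 j1 P1' Q1' j2 P2' Q2' j3 P3' Q3'
    k1 D1' E1' k2 D2' E2' k3 D3' E3' : ℤ}
    (hU : Up W j) (C1 : Cov W P1 Q1) (C2 : Cov (mvW W P1 Q1) P2 Q2)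
    (C3 : Cov (mvW (mvW W P1 Q1) P2 Q2) P3 Q3)
    (S1 : Step W j P1 Q1 j1 P1' Q1') (S2 : Step (mvW W P1 Q1) j1 P2 Q2 j2 P2' Q2')
    (S3 : Step (mvW (mvW W P1 Q1) P2 Q2) j2 P3 Q3 j3 P3' Q3')
    (h21 : P2 < Q1) (h23 : Q2 < P3) (h31 : P3 ≤ Q1)
    (T1 : Step W j P2 Q2 k1 D1' E1') (T2 : Step (mvW W P2 Q2) k1 P1 Q1 k2 D2' E2')
    (T3 : Step (mvW (mvW W P2 Q2) P1 Q1) k2 P3 Q3 k3 D3' E3') :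
    j3 = k3 ∧ Rel P1' Q1' P2' Q2' P3' Q3' D1' E1' D2' E2' D3' E3' := by
  have hPQ1 := C1.1
  have hPQ2 := C2.1
  rw [mv_comm W (P := P2) (Q := Q2) (P' := P1) (Q' := Q1) (by omega) (by omega) (by omega) (by omega)] at T3
  by_cases hb : Q2 = j ∧ P2 = j + 1
  · -- `c2` in conflict
    obtain ⟨rfl, rfl⟩ := hb
    obtain ⟨t1, t2, t3⟩ := Step_c T1 ⟨rfl, rfl⟩
    obtain ⟨s1, s2, s3⟩ := Step_nc S1 (by omega)
    rw [sj_far (by omega) (by omega)] at s2 s3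
    subst s1
    obtain ⟨u1, u2, u3⟩ := Step_c S2 ⟨rfl, rfl⟩
    have hsw : mvW (mvW W P1 Q1) (j1 + 1) j1 = mvW (mvW W (j1 + 1) j1) P1 Q1 :=
      mv_comm W (by omega) (by omega) (by omega) (by omega)
    rw [hsw] at S3 T3 C3
    obtain ⟨m1, m2, m3⟩ := mv_facts W (j1 + 1) j1
    obtain ⟨n1, n2, n3⟩ := mv_facts W P1 Q1
    obtain ⟨q1, q2, q3⟩ := mv_facts (mvW W (j1 + 1) j1) P1 Q1
    have hW0 : W j1 ≤ 0 := by rw [← n3 j1 (by omega) (by omega)]; exact C2.2.2.1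
    have hne : P3 ≠ j1 + 1 := by
      intro h
      have := C3.2.1
      rw [h, q3 _ (by omega) (by omega), m2] at this
      omega
    have K : Cov (mvW W (j1 + 1) j1) P1 Q1 := by
      obtain ⟨x1, x2, x3, x4⟩ := C1
      refine ⟨x1, by rw [m3 _ (by omega) (by omega)]; exact x2,
        by rw [m3 _ (by omega) (by omega)]; exact x3, fun t t1 t2 => ?_⟩
      rw [m3 _ (by omega) (by omega), m3 _ (by omega) (by omega)]; exact x4 t t1 t2
    subst s2 s3 t2 t3 u2 u3
    refine clash (l := j1 + 1) K C3 (by rw [m2]; exact hW0) (by omega) h31 ?_ ?_ S3 T2 T3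
    · exact LL_congr t1 fun t t1 _ => m3 t (by omega) (by omega)
    · rw [← hsw]
      exact LL_congr u1 fun t t1 _ => (mv_facts _ _ _).2.2 t (by omega) (by omega)
  by_cases ha : Q1 = j ∧ P1 = j + 1
  · obtain ⟨rfl, rfl⟩ := ha
    obtain ⟨s1, s2, s3⟩ := Step_c S1 ⟨rfl, rfl⟩
    have hlt := s1.1
    subst s2 s3
    obtain ⟨u1, u2, u3⟩ := Step_nc S2 (by omega)
    rw [sj_far (by omega) (by omega)] at u2 u3
    obtain ⟨v1, v2, v3⟩ := Step_nc T1 hb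
    rw [sj_far (by omega) (by omega)] at v2 v3
    subst v1
    obtain ⟨w1, w2, w3⟩ := Step_c T2 ⟨rfl, rfl⟩
    have := LL_iff s1 (V := mvW W P2 Q2) (fun t t1 _ => (mv_facts _ _ _).2.2 t (by omega) (by omega)) w1
    subst this w3 u1
    obtain ⟨g1, g2, g3⟩ := Step_det S3 T3
    obtain ⟨f1, f2, f3⟩ := Step_nc S3 (by omega)
    rw [sj_far (by omega) (by omega)] at f2
    exact ⟨g1, Or.inl (by omega)⟩
  · obtain ⟨s1, s2, s3⟩ := Step_nc S1 ha
    subst s1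
    obtain ⟨u1, u2, u3⟩ := Step_nc S2 hb
    obtain ⟨v1, v2, v3⟩ := Step_nc T1 hb
    subst v1
    obtain ⟨w1, w2, w3⟩ := Step_nc T2 ha
    have U1 := (step_single C1 hU S1).2.1
    have U2 := (step_single C2 U1 S2).2.1
    subst u1 w1
    obtain ⟨g1, g2, g3⟩ := Step_det S3 T3
    refine ⟨g1, Or.inl ?_⟩
    obtain ⟨m1, m2, m3⟩ := mv_facts W P1 Q1
    obtain ⟨n1, n2, n3⟩ := mv_facts (mvW W P1 Q1) P2 Q2
    have x1 : Q1 ≠ k2 + 1 := by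
      intro h; have := hU.2; have := C1.2.2.1; rw [h] at this; omega
    have x2 : 0 < mvW (mvW W P1 Q1) P2 Q2 Q2 := by rw [n1]; exact C2.2.1
    have x3 : 0 < mvW (mvW W P1 Q1) P2 Q2 Q1 := by
      rw [n3 _ (by omega) (by omega), m1]; exact C1.2.1
    generalize mvW (mvW W P1 Q1) P2 Q2 = V at *
    have x4 : ¬ (Q2 = k2 ∧ P3 = k2 + 1) := by
      rintro ⟨rfl, rfl⟩
      have := C3.2.2.1
      have y := C3.1
      rcases eq_or_ne Q3 Q2 with h | h
      · rw [h] at this; omega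
      · have := C3.2.2.2 Q2 (by omega) (by omega)
        have := U2.1; omega
    by_cases hc : Q3 = k2 ∧ P3 = k2 + 1
    · obtain ⟨b1, b2, b3⟩ := Step_c S3 hc
      have : P3' ≤ Q1 := by
        by_contra hh
        have := b1.2.2 Q1 (by omega) (by omega)
        omega
      have := b1.1
      clear S3 T3 S1 S2 T1 T2 m3 n3 C1 C2 C3
      rw [sj_far (t := Q1) (by omega) (by omega)] at *
      have : Q2' ≤ k2 + 1 := by grind [sj]
      have : P2' < Q1 := by grind [sj]
      omega
    · obtain ⟨f1, f2, f3⟩ := Step_nc S3 hc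
      clear S3 T3 S1 S2 T1 T2 m3 n3 C1 C2 C3
      subst s2 s3 u2 u3 v2 v3 w2 w3 f2 f3
      refine ⟨rfl, rfl, rfl, rfl, g2.symm, g3.symm, ?_, ?_, ?_⟩
      all_goals (clear g2 g3; simp only [sj]; split_ifs <;> omega)


theorem local_TB {W : ℤ → ℤ} {j P1 Q1 P2 Q2 P3 Q3 j1 P1' Q1' j2 P2' Q2' j3 P3' Q3'
    k1 D1' E1' k2 D2' E2' k3 D3' E3' : ℤ}
    (hU : Up W j) (C1 : Cov W P1 Q1) (C2 : Cov (mvW W P1 Q1) P2 Q2)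
    (C3 : Cov (mvW (mvW W P1 Q1) P2 Q2) P3 Q3)
    (S1 : Step W j P1 Q1 j1 P1' Q1') (S2 : Step (mvW W P1 Q1) j1 P2 Q2 j2 P2' Q2')
    (S3 : Step (mvW (mvW W P1 Q1) P2 Q2) j2 P3 Q3 j3 P3' Q3')
    (h13 : P1 ≤ Q3) (h21 : P2 ≤ Q1)
    (T1 : Step W j P1 Q1 k1 D1' E1') (T2 : Step (mvW W P1 Q1) k1 P3 Q3 k2 D2' E2')
    (T3 : Step (mvW (mvW W P1 Q1) P3 Q3) k2 P2 Q2 k3 D3' E3') :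
    j3 = k3 ∧ Rel P1' Q1' P2' Q2' P3' Q3' D1' E1' D2' E2' D3' E3' := by
  have hPQ1 := C1.1
  have hPQ2 := C2.1
  have hPQ3 := C3.1
  obtain ⟨e1, e2, e3⟩ := Step_det S1 T1
  subst e1 e2 e3
  have U1 := (step_single C1 hU S1).2.1
  obtain ⟨m1, m2, m3⟩ := mv_facts W P1 Q1
  have a1 : 0 < mvW W P1 Q1 Q1 := by rw [m1]; exact C1.2.1
  obtain ⟨n1, n2, n3⟩ := mv_facts (mvW W P1 Q1) P2 Q2
  have a3 : mvW W P1 Q1 Q3 ≤ 0 := by rw [← n3 _ (by omega) (by omega)]; exact C3.2.2.1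
  have a3' : 0 < mvW W P1 Q1 P3 := by rw [← n3 _ (by omega) (by omega)]; exact C3.2.1
  have a4 : ∀ t, Q3 < t → t < P3 → mvW W P1 Q1 P3 < mvW W P1 Q1 t := by
    intro t t1 t2
    rw [← n3 _ (by omega) (by omega), ← n3 t (by omega) (by omega)]; exact C3.2.2.2 t t1 t2
  by_cases ha : Q1 = j ∧ P1 = j + 1
  · obtain ⟨rfl, rfl⟩ := ha
    obtain ⟨s1, s2, s3⟩ := Step_c S1 ⟨rfl, rfl⟩
    have hlt := s1.1
    subst s2 s3
    obtain ⟨u1, u2, u3⟩ := Step_nc S2 (by omega)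
    rw [sj_far (by omega) (by omega)] at u2 u3
    subst u1 u2 u3
    have L1 : LL (mvW W (Q1 + 1) Q1) (Q1 + 1) P1' :=
      LL_congr s1 fun t t1 _ => m3 t (by omega) (by omega)
    by_cases hc : Q3 = P1' - 1 ∧ P3 = P1' - 1 + 1
    · obtain ⟨b1, b2, b3⟩ := Step_c S3 hc
      obtain ⟨d1, d2, d3⟩ := Step_c T2 hc
      have := LL_iff d1 (V := mvW (mvW W (Q1+1) Q1) P2' Q2')
        (fun t t1 _ => n3 t (by omega) (by omega)) b1
      have := b1.1
      obtain ⟨f1, f2, f3⟩ := Step_nc T3 (by omega)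
      rw [sj_far (by omega) (by omega)] at f2 f3
      exact ⟨by omega, Or.inr (Or.inl (by omega))⟩
    · obtain ⟨b1, b2, b3⟩ := Step_nc S3 hc
      obtain ⟨d1, d2, d3⟩ := Step_nc T2 hc
      obtain ⟨f1, f2, f3⟩ := Step_nc T3 (by omega)
      rw [sj_far (by omega) (by omega)] at f2 f3
      have x1 : Q3 ≠ P1' := by
        rintro rfl
        have := L1.2.1
        omega
      have x2 : ¬ Q3 < P1' - 1 := by
        intro h
        have y1 := L1.2.2 (Q3 + 1) (by omega) (by omega)
        rcases eq_or_ne P3 (Q3 + 1) with h' | h'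
        · rw [h'] at a3'; omega
        · have := a4 (Q3 + 1) (by omega) (by omega)
          omega
      have x3 : P1' ≤ Q3' := by
        rw [b3]; simp only [sj]; split_ifs <;> omega
      exact ⟨by omega, Or.inr (Or.inl (by omega))⟩
  · obtain ⟨s1, s2, s3⟩ := Step_nc S1 ha
    subst s1
    have x1 : Q1 ≠ j1 + 1 := by
      intro h; have := hU.2; have := C1.2.2.1; rw [h] at this; omega
    have x2 : Q3 ≠ j1 + 1 := by
      intro h; have := U1.2; rw [h] at a3; omega
    by_cases hb : Q2 = j1 ∧ P2 = j1 + 1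
    · obtain ⟨rfl, rfl⟩ := hb
      obtain ⟨u1, u2, u3⟩ := Step_c S2 ⟨rfl, rfl⟩
      have hr : P2' ≤ Q1 := by
        by_contra hh
        have := u1.2.2 Q1 (by omega) (by omega)
        omega
      rw [sj_far (by omega) (by omega)] at s2 s3
      obtain ⟨v1, v2, v3⟩ := Step_nc T2 (by omega)
      rw [sj_far (by omega) (by omega)] at v2 v3
      subst v1
      obtain ⟨w1, w2, w3⟩ := Step_c T3 ⟨rfl, rfl⟩
      have := LL_iff u1 (V := mvW (mvW W P1 Q1) P3 Q3)
        (fun t _ t1 => (mv_facts _ _ _).2.2 t (by omega) (by omega)) w1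
      obtain ⟨b1, b2, b3⟩ := Step_nc S3 (by omega)
      rw [sj_far (by omega) (by omega)] at b2 b3
      exact ⟨by omega, Or.inr (Or.inl (by omega))⟩
    · obtain ⟨u1, u2, u3⟩ := Step_nc S2 hb
      subst u1
      by_cases hc : Q3 = j2 ∧ P3 = j2 + 1
      · obtain ⟨b1, b2, b3⟩ := Step_c S3 hc
        obtain ⟨d1, d2, d3⟩ := Step_c T2 hc
        have := LL_iff d1 (V := mvW (mvW W P1 Q1) P2 Q2)
          (fun t t1 _ => n3 t (by omega) (by omega)) b1
        have := b1.1
        rw [sj_far (by omega) (by omega)] at u2 u3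
        obtain ⟨f1, f2, f3⟩ := Step_nc T3 (by omega)
        rw [sj_far (by omega) (by omega)] at f2 f3
        have y1 : P1' ≤ j2 + 1 := by rw [s2]; simp only [sj]; split_ifs <;> omega
        have y2 : P2 ≤ Q1' := by rw [s3]; simp only [sj]; split_ifs <;> omega
        exact ⟨by omega, Or.inr (Or.inl (by omega))⟩
      · obtain ⟨b1, b2, b3⟩ := Step_nc S3 hc
        obtain ⟨d1, d2, d3⟩ := Step_nc T2 hc
        subst d1
        obtain ⟨f1, f2, f3⟩ := Step_nc T3 hb
        have y1 : P1' ≤ Q3' := by rw [s2, b3]; simp only [sj]; split_ifs <;> omega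
        have y2 : P2' ≤ Q1' := by rw [s3, u2]; simp only [sj]; split_ifs <;> omega
        exact ⟨by omega, Or.inr (Or.inl (by omega))⟩

theorem local_TC {W : ℤ → ℤ} {j P1 Q1 Q2 P3 j1 P1' Q1' j2 P2' Q2' j3 P3' Q3'
    k1 D1' E1' k2 D2' E2' k3 D3' E3' : ℤ}
    (hU : Up W j) (C1 : Cov W P1 Q1)
    (S1 : Step W j P1 Q1 j1 P1' Q1') (S2 : Step (mvW W P1 Q1) j1 Q1 Q2 j2 P2' Q2')
    (S3 : Step (mvW (mvW W P1 Q1) Q1 Q2) j2 P3 Q1 j3 P3' Q3')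
    (h21 : Q2 < Q1) (h13 : Q1 < P3) (h31 : P3 < P1)
    (T1 : Step W j P3 Q1 k1 D1' E1') (T2 : Step (mvW W P3 Q1) k1 P1 P3 k2 D2' E2')
    (T3 : Step (mvW (mvW W P3 Q1) P1 P3) k2 P3 Q2 k3 D3' E3') :
    j3 = k3 ∧ Rel P1' Q1' P2' Q2' P3' Q3' D1' E1' D2' E2' D3' E3' := by
  obtain ⟨-, hP1, hQ1, hb⟩ := C1
  obtain ⟨s1, s2, s3⟩ := Step_nc S1 (by omega)
  subst s1
  have x1 : Q1 ≠ j1 + 1 := by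
    intro h; have := hU.2; rw [h] at hQ1; omega
  obtain ⟨u1, u2, u3⟩ := Step_nc S2 (by omega)
  subst u1
  have x2 : ¬ (P3 = j2 ∧ P1 = j2 + 1) := by
    rintro ⟨rfl, rfl⟩
    have := hU.1
    have := hb P3 h13 h31
    omega
  obtain ⟨m1, m2, m3⟩ := mv_facts W P1 Q1
  obtain ⟨n1, n2, n3⟩ := mv_facts (mvW W P1 Q1) Q1 Q2
  obtain ⟨o1, o2, o3⟩ := mv_facts W P3 Q1
  by_cases hc : Q1 = j2 ∧ P3 = j2 + 1
  · obtain ⟨rfl, rfl⟩ := hc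
    obtain ⟨b1, b2, b3⟩ := Step_c S3 ⟨rfl, rfl⟩
    obtain ⟨d1, d2, d3⟩ := Step_c T1 ⟨rfl, rfl⟩
    rw [sj_far (by omega) (by omega)] at s2 u3
    by_cases hadj : P1 = Q1 + 2
    · subst hadj
      have : LL W (Q1 + 1) (Q1 + 2) := ⟨by omega, hP1, fun t t1 t2 => by omega⟩
      have hr := LL_unique d1 this
      subst hr d3
      obtain ⟨e1, e2, e3⟩ := Step_c T2 ⟨by omega, by omega⟩
      have hlt := e1.1
      have : LL (mvW (mvW W (Q1 + 2) Q1) Q1 Q2) (Q1 + 1) D2' := by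
        obtain ⟨z1, z2, z3⟩ := e1
        refine ⟨by omega, ?_, fun t t1 t2 => ?_⟩
        · rw [n3 _ (by omega) (by omega), m3 _ (by omega) (by omega),
            ← o3 _ (by omega) (by omega)]; exact z2
        · rw [n3 _ (by omega) (by omega)]
          rcases eq_or_lt_of_le (show Q1 + 2 ≤ t by omega) with h | h
          · rw [← h, m2]; exact hQ1
          · rw [m3 _ (by omega) (by omega), ← o3 _ (by omega) (by omega)]
            exact z3 t (by omega) t2
      have hD := LL_unique this b1
      subst hD e3
      obtain ⟨f1, f2, f3⟩ := Step_nc T3 (by omega)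
      rw [sj_far (by omega) (by omega)] at f2 f3
      refine ⟨by omega, Or.inr (Or.inl ?_)⟩
      grind [sj]
    · have hpos := hb (Q1 + 2) (by omega) (by omega)
      have : LL W (Q1 + 1) (Q1 + 2) := ⟨by omega, by omega, fun t t1 t2 => by omega⟩
      have hr := LL_unique d1 this
      subst hr d3
      have : LL (mvW (mvW W P1 Q1) Q1 Q2) (Q1 + 1) (Q1 + 2) := by
        refine ⟨by omega, ?_, fun t t1 t2 => by omega⟩
        rw [n3 _ (by omega) (by omega), m3 _ (by omega) (by omega)]; omega
      have hr := LL_unique b1 this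
      subst hr
      obtain ⟨e1, e2, e3⟩ := Step_nc T2 (by omega)
      subst e1
      obtain ⟨f1, f2, f3⟩ := Step_nc T3 (by omega)
      refine ⟨by omega, Or.inr (Or.inr ?_)⟩
      grind [sj]
  · obtain ⟨b1, b2, b3⟩ := Step_nc S3 hc
    obtain ⟨d1, d2, d3⟩ := Step_nc T1 hc
    subst d1
    obtain ⟨e1, e2, e3⟩ := Step_nc T2 x2
    subst e1
    obtain ⟨f1, f2, f3⟩ := Step_nc T3 (by omega)
    refine ⟨by omega, Or.inr (Or.inr ⟨by omega, by omega, by omega, by omega, by omega, by omega, by omega, by omega, ?_, ?_, ?_⟩)⟩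
    · rw [u3, s3]; simp only [sj]; split_ifs <;> omega
    · rw [s3, b2]; simp only [sj]; split_ifs <;> omega
    · rw [s2, b2]; simp only [sj]; split_ifs <;> omega

theorem local_all {W : ℤ → ℤ} {j P1 Q1 P2 Q2 P3 Q3 D1 E1 D2 E2 D3 E3 j1 P1' Q1' j2 P2' Q2' j3 P3' Q3'
    k1 D1' E1' k2 D2' E2' k3 D3' E3' : ℤ}
    (hU : Up W j) (C1 : Cov W P1 Q1) (C2 : Cov (mvW W P1 Q1) P2 Q2)
    (C3 : Cov (mvW (mvW W P1 Q1) P2 Q2) P3 Q3)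
    (S1 : Step W j P1 Q1 j1 P1' Q1') (S2 : Step (mvW W P1 Q1) j1 P2 Q2 j2 P2' Q2')
    (S3 : Step (mvW (mvW W P1 Q1) P2 Q2) j2 P3 Q3 j3 P3' Q3')
    (hR : Rel P1 Q1 P2 Q2 P3 Q3 D1 E1 D2 E2 D3 E3)
    (T1 : Step W j D1 E1 k1 D1' E1') (T2 : Step (mvW W D1 E1) k1 D2 E2 k2 D2' E2')
    (T3 : Step (mvW (mvW W D1 E1) D2 E2) k2 D3 E3 k3 D3' E3') :
    j3 = k3 ∧ Rel P1' Q1' P2' Q2' P3' Q3' D1' E1' D2' E2' D3' E3' := by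
  rcases hR with ⟨rfl, rfl, rfl, rfl, rfl, rfl, h1, h2, h3⟩ | ⟨rfl, rfl, rfl, rfl, rfl, rfl, h1, h2⟩ |
    ⟨rfl, rfl, rfl, rfl, rfl, rfl, rfl, rfl, h1, h2, h3⟩
  · exact local_TA hU C1 C2 C3 S1 S2 S3 h1 h2 h3 T1 T2 T3
  · exact local_TB hU C1 C2 C3 S1 S2 S3 h1 h2 T1 T2 T3
  · exact local_TC hU C1 S1 S2 S3 h1 h2 h3 T1 T2 T3

/-- pair version: the insertion of `x`, then `y`, `x ≤ y` -/
theorem local_pair {W : ℤ → ℤ} {j P1 Q1 P3 Q3 j1 P1' Q1' j3 P3' Q3' : ℤ}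
    (hU : Up W j) (C1 : Cov W P1 Q1) (C3 : Cov (mvW W P1 Q1) P3 Q3)
    (S1 : Step W j P1 Q1 j1 P1' Q1') (S3 : Step (mvW W P1 Q1) j1 P3 Q3 j3 P3' Q3')
    (h : P3 ≤ Q1) : P3' ≤ Q1' := by
  have hPQ1 := C1.1
  have hPQ3 := C3.1
  obtain ⟨m1, m2, m3⟩ := mv_facts W P1 Q1
  have a1 : 0 < mvW W P1 Q1 Q1 := by rw [m1]; exact C1.2.1
  by_cases ha : Q1 = j ∧ P1 = j + 1
  · obtain ⟨s1, s2, s3⟩ := Step_c S1 ha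
    have hlt := s1.1
    obtain ⟨u1, u2, u3⟩ := Step_nc S3 (by omega)
    rw [sj_far (by omega) (by omega)] at u2
    omega
  · obtain ⟨s1, s2, s3⟩ := Step_nc S1 ha
    subst s1
    have x1 : Q1 ≠ j1 + 1 := by
      intro h; have := hU.2; have := C1.2.2.1; rw [h] at this; omega
    by_cases hb : Q3 = j1 ∧ P3 = j1 + 1
    · obtain ⟨u1, u2, u3⟩ := Step_c S3 hb
      rw [sj_far (by omega) (by omega)] at s3
      by_contra hh
      have := u1.2.2 Q1 (by omega) (by omega)
      omega
    · obtain ⟨u1, u2, u3⟩ := Step_nc S3 hb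
      rw [s3, u2]; simp only [sj]; split_ifs <;> omega


def run (W : ℤ → ℤ) : List ℤ → (ℤ → ℤ)
  | [] => W
  | j :: l => run (swW W j) l

def Asc (W : ℤ → ℤ) : List ℤ → Prop
  | [] => True
  | j :: l => Up W j ∧ Asc (swW W j) l

def Tr (W : ℤ → ℤ) (P Q : ℤ) : List ℤ → List ℤ → ℤ → ℤ → Prop
  | [], l', P', Q' => l' = [] ∧ P' = P ∧ Q' = Q
  | j :: l, l', P', Q' => ∃ j' l'' P1 Q1, l' = j' :: l'' ∧ Step W j P Q j' P1 Q1 ∧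
      Tr (swW W j) P1 Q1 l l'' P' Q'

theorem run_append (W : ℤ → ℤ) (l m : List ℤ) : run W (l ++ m) = run (run W l) m := by
  induction l generalizing W with
  | nil => rfl
  | cons j l ih => exact ih _

theorem Asc_append (W : ℤ → ℤ) (l m : List ℤ) : Asc W (l ++ m) ↔ Asc W l ∧ Asc (run W l) m := by
  induction l generalizing W with
  | nil => simp [Asc, run]
  | cons j l ih => simp only [List.cons_append, Asc, run, ih, and_assoc]

theorem Tr_append {W : ℤ → ℤ} {P Q P' Q' : ℤ} {l m l' : List ℤ} (h : Tr W P Q (l ++ m) l' P' Q') :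
    ∃ l1 m1 P1 Q1, l' = l1 ++ m1 ∧ Tr W P Q l l1 P1 Q1 ∧ Tr (run W l) P1 Q1 m m1 P' Q' := by
  induction l generalizing W P Q l' with
  | nil => exact ⟨[], l', P, Q, rfl, ⟨rfl, rfl, rfl⟩, h⟩
  | cons j l ih =>
    obtain ⟨j', l'', P1, Q1, rfl, hS, hT⟩ := h
    obtain ⟨l1, m1, P2, Q2, rfl, h1, h2⟩ := ih hT
    exact ⟨j' :: l1, m1, P2, Q2, rfl, ⟨j', l1, P1, Q1, rfl, hS, h1⟩, h2⟩

theorem Tr_append' {W : ℤ → ℤ} {P Q P1 Q1 P' Q' : ℤ} {l m l1 m1 : List ℤ}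
    (h1 : Tr W P Q l l1 P1 Q1) (h2 : Tr (run W l) P1 Q1 m m1 P' Q') :
    Tr W P Q (l ++ m) (l1 ++ m1) P' Q' := by
  induction l generalizing W P Q l1 with
  | nil => obtain ⟨rfl, rfl, rfl⟩ := h1; exact h2
  | cons j l ih =>
    obtain ⟨j', l'', P1, Q1, rfl, hS, hT⟩ := h1
    exact ⟨j', l'' ++ m1, P1, Q1, rfl, hS, ih hT h2⟩

theorem Tr_det {W : ℤ → ℤ} {P Q P' Q' P'' Q'' : ℤ} {l l' l'' : List ℤ} (h1 : Tr W P Q l l' P' Q')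
    (h2 : Tr W P Q l l'' P'' Q'') : l' = l'' ∧ P' = P'' ∧ Q' = Q'' := by
  induction l generalizing W P Q l' l'' with
  | nil => obtain ⟨rfl, rfl, rfl⟩ := h1; obtain ⟨rfl, rfl, rfl⟩ := h2; simp
  | cons j l ih =>
    obtain ⟨j1, l1, P1, Q1, rfl, hS, hT⟩ := h1
    obtain ⟨j2, l2, P2, Q2, rfl, hS', hT'⟩ := h2
    obtain ⟨rfl, rfl, rfl⟩ := Step_det hS hS'
    obtain ⟨rfl, h⟩ := ih hT hT'
    exact ⟨rfl, h⟩

theorem Tr_single {W : ℤ → ℤ} {P Q P' Q' : ℤ} {l l' : List ℤ} (hC : Cov W P Q) (hA : Asc W l)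
    (h : Tr W P Q l l' P' Q') :
    Cov (run W l) P' Q' ∧ Asc (mvW W P Q) l' ∧ run (mvW W P Q) l' = mvW (run W l) P' Q' := by
  induction l generalizing W P Q l' with
  | nil => obtain ⟨rfl, rfl, rfl⟩ := h; exact ⟨hC, trivial, rfl⟩
  | cons j l ih =>
    obtain ⟨j1, l1, P1, Q1, rfl, hS, hT⟩ := h
    obtain ⟨h1, h2, h3⟩ := step_single hC hA.1 hS
    obtain ⟨g1, g2, g3⟩ := ih h1 hA.2 hT
    rw [h3] at g2 g3
    exact ⟨g1, ⟨h2, g2⟩, g3⟩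

theorem Tr_pair {W : ℤ → ℤ} {P1 Q1 P1' Q1' P3 Q3 P3' Q3' : ℤ} {l l1 l3 : List ℤ} (hA : Asc W l)
    (C1 : Cov W P1 Q1) (C3 : Cov (mvW W P1 Q1) P3 Q3)
    (S1 : Tr W P1 Q1 l l1 P1' Q1') (S3 : Tr (mvW W P1 Q1) P3 Q3 l1 l3 P3' Q3')
    (h : P3 ≤ Q1) : P3' ≤ Q1' := by
  induction l generalizing W P1 Q1 P3 Q3 l1 l3 with
  | nil => obtain ⟨rfl, rfl, rfl⟩ := S1; obtain ⟨rfl, rfl, rfl⟩ := S3; exact h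
  | cons j l ih =>
    obtain ⟨j1, l1, P1, Q1, rfl, S, T⟩ := S1
    obtain ⟨j3, l3, P3, Q3, rfl, S', T'⟩ := S3
    obtain ⟨a1, a2, a3⟩ := step_single C1 hA.1 S
    obtain ⟨b1, b2, b3⟩ := step_single C3 a2 S'
    rw [← a3] at b1 T'
    exact ih hA.2 a1 b1 T T' (local_pair hA.1 C1 C3 S S' h)

theorem Tr_triple {W : ℤ → ℤ} {P1 Q1 P2 Q2 P3 Q3 D1 E1 D2 E2 D3 E3
    P1' Q1' P2' Q2' P3' Q3' D1' E1' D2' E2' D3' E3' : ℤ} {l l1 l2 l3 m1 m2 m3 : List ℤ}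
    (hA : Asc W l) (C1 : Cov W P1 Q1) (C2 : Cov (mvW W P1 Q1) P2 Q2)
    (C3 : Cov (mvW (mvW W P1 Q1) P2 Q2) P3 Q3)
    (C1' : Cov W D1 E1) (C2' : Cov (mvW W D1 E1) D2 E2)
    (C3' : Cov (mvW (mvW W D1 E1) D2 E2) D3 E3)
    (S1 : Tr W P1 Q1 l l1 P1' Q1') (S2 : Tr (mvW W P1 Q1) P2 Q2 l1 l2 P2' Q2')
    (S3 : Tr (mvW (mvW W P1 Q1) P2 Q2) P3 Q3 l2 l3 P3' Q3')
    (hR : Rel P1 Q1 P2 Q2 P3 Q3 D1 E1 D2 E2 D3 E3)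
    (T1 : Tr W D1 E1 l m1 D1' E1') (T2 : Tr (mvW W D1 E1) D2 E2 m1 m2 D2' E2')
    (T3 : Tr (mvW (mvW W D1 E1) D2 E2) D3 E3 m2 m3 D3' E3') :
    l3 = m3 ∧ Rel P1' Q1' P2' Q2' P3' Q3' D1' E1' D2' E2' D3' E3' := by
  induction l generalizing W P1 Q1 P2 Q2 P3 Q3 D1 E1 D2 E2 D3 E3 l1 l2 l3 m1 m2 m3 with
  | nil =>
    obtain ⟨rfl, rfl, rfl⟩ := S1; obtain ⟨rfl, rfl, rfl⟩ := S2; obtain ⟨rfl, rfl, rfl⟩ := S3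
    obtain ⟨rfl, rfl, rfl⟩ := T1; obtain ⟨rfl, rfl, rfl⟩ := T2; obtain ⟨rfl, rfl, rfl⟩ := T3
    exact ⟨rfl, hR⟩
  | cons j l ih =>
    obtain ⟨j1, l1, a1, b1, rfl, S1, S1'⟩ := S1
    obtain ⟨j2, l2, a2, b2, rfl, S2, S2'⟩ := S2
    obtain ⟨j3, l3, a3, b3, rfl, S3, S3'⟩ := S3
    obtain ⟨k1, m1, e1, f1, rfl, T1, T1'⟩ := T1
    obtain ⟨k2, m2, e2, f2, rfl, T2, T2'⟩ := T2
    obtain ⟨k3, m3, e3, f3, rfl, T3, T3'⟩ := T3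
    obtain ⟨x1, y1, z1⟩ := step_single C1 hA.1 S1
    obtain ⟨x2, y2, z2⟩ := step_single C2 y1 S2
    obtain ⟨x3, y3, z3⟩ := step_single C3 y2 S3
    obtain ⟨u1, v1, w1⟩ := step_single C1' hA.1 T1
    obtain ⟨u2, v2, w2⟩ := step_single C2' v1 T2
    obtain ⟨u3, v3, w3⟩ := step_single C3' v2 T3
    rw [← z2] at S3' x3
    rw [← z1] at S2' S3' x2 x3
    rw [← w2] at T3' u3
    rw [← w1] at T2' T3' u2 u3
    obtain ⟨rfl, hR'⟩ := local_all hA.1 C1 C2 C3 S1 S2 S3 hR T1 T2 T3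
    obtain ⟨rfl, h⟩ := ih hA.2 x1 x2 x3 u1 u2 u3 S1' S2' S3' hR' T1' T2' T3'
    exact ⟨rfl, h⟩

/-- word after the rows `1,…,k` -/
def wd (f : ℕ → List ℤ) : ℕ → (ℤ → ℤ)
  | 0 => id
  | k + 1 => run (wd f k) (f (k + 1))

def Good (f : ℕ → List ℤ) : Prop := ∀ k, Asc (wd f k) (f (k + 1))

def FL (W : ℤ → ℤ) (r : ℤ) : Prop := (∀ t, t < r → W t ≤ 0) ∧ 0 < W r

structure Ins (f : ℕ → List ℤ) (k : ℕ) (f' : ℕ → List ℤ) (P Q : ℕ → ℤ) : Prop where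
  lo : ∀ i, i < k → f' i = f i
  fl : FL (wd f k) (P k)
  q : Q k = P k - 1
  row : f' k = f k ++ [P k - 1]
  tr : ∀ i, k ≤ i → Tr (wd f i) (P i) (Q i) (f (i + 1)) (f' (i + 1)) (P (i + 1)) (Q (i + 1))

theorem wd_congr {f g : ℕ → List ℤ} {z : ℕ} (h : ∀ i, i < z → f i = g i) :
    ∀ i, i < z → wd f i = wd g i := by
  intro i
  induction i with
  | zero => intro _; rfl
  | succ i ih => intro hi; simp only [wd]; rw [ih (by omega), h _ hi]

theorem FL_unique {W : ℤ → ℤ} {r r' : ℤ} (h : FL W r) (h' : FL W r') : r = r' := by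
  by_contra hne
  rcases lt_or_gt_of_ne hne with hlt | hlt
  · have := h'.1 r hlt; have := h.2; omega
  · have := h.1 r' hlt; have := h'.2; omega

theorem Ins.step {f f' : ℕ → List ℤ} {k : ℕ} {P Q : ℕ → ℤ} (h : Ins f k f' P Q) (hk : 0 < k)
    (hG : Good f) (i : ℕ) (hi : k ≤ i) :
    Cov (wd f i) (P i) (Q i) ∧ wd f' i = mvW (wd f i) (P i) (Q i) := by
  induction i, hi using Nat.le_induction with
  | base =>
    have hq := h.q
    refine ⟨⟨by omega, h.fl.2, by rw [hq]; exact h.fl.1 _ (by omega), fun t t1 t2 => by omega⟩, ?_⟩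
    obtain ⟨k, rfl⟩ : ∃ k', k = k' + 1 := ⟨k - 1, by omega⟩
    have hw := wd_congr h.lo k (by omega)
    have : wd f' (k + 1) = swW (wd f (k + 1)) (P (k + 1) - 1) := by
      show run (wd f' k) (f' (k + 1)) = _
      rw [hw, h.row, run_append]; rfl
    rw [this, hq]
    funext t
    simp only [swW, mvW, sj]
    congr 1
    split_ifs <;> omega
  | succ i hi ih =>
    obtain ⟨h1, h2⟩ := ih
    obtain ⟨a1, a2, a3⟩ := Tr_single h1 (hG i) (h.tr i hi)
    exact ⟨a1, by rw [← show run (wd f i) (f (i+1)) = wd f (i+1) from rfl, ← a3, ← h2]; rfl⟩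

theorem Ins.good {f f' : ℕ → List ℤ} {k : ℕ} {P Q : ℕ → ℤ} (h : Ins f k f' P Q) (hk : 0 < k)
    (hG : Good f) : Good f' := by
  intro i
  rcases lt_trichotomy (i + 1) k with hi | hi | hi
  · rw [h.lo _ hi, wd_congr h.lo i (by omega)]; exact hG i
  · rw [wd_congr h.lo i (by omega)]
    have hr := h.row
    have hf := h.fl
    rw [← hi] at hr hf
    rw [hr, Asc_append]
    refine ⟨hG i, ⟨?_, trivial⟩⟩
    have h1 := hf.1 (P (i+1) - 1) (by omega)
    have h2 := hf.2
    change 0 < run (wd f i) (f (i+1)) _ at h2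
    change run (wd f i) (f (i+1)) _ ≤ 0 at h1
    refine ⟨?_, ?_⟩
    · rw [sub_add_cancel]; omega
    · rw [sub_add_cancel]; omega
  · obtain ⟨h1, h2⟩ := h.step hk hG i (by omega)
    rw [h2]
    exact (Tr_single h1 (hG i) (h.tr i (by omega))).2.1

theorem Ins_det {f f' g g' : ℕ → List ℤ} {k z : ℕ} {P Q P' Q' : ℕ → ℤ} (h : Ins f k f' P Q)
    (h' : Ins g k g' P' Q') (hfg : ∀ i, i < z → f i = g i) :
    (∀ i, i < z → f' i = g' i) ∧ ∀ i, k ≤ i → i < z → P i = P' i ∧ Q i = Q' i := by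
  have key : ∀ i, k ≤ i → i < z → f' i = g' i ∧ P i = P' i ∧ Q i = Q' i := by
    intro i hi
    induction i, hi using Nat.le_induction with
    | base =>
      intro hz
      have e := wd_congr hfg k hz
      have h1 := h.fl
      rw [e] at h1
      have h2 := FL_unique h1 h'.fl
      refine ⟨by rw [h.row, h'.row, hfg _ hz, h2], h2, by rw [h.q, h'.q, h2]⟩
    | succ i hi ih =>
      intro hz
      obtain ⟨a1, a2, a3⟩ := ih (by omega)
      have h1 := h.tr i hi
      rw [wd_congr hfg i (by omega), a2, a3, hfg _ hz] at h1
      exact Tr_det h1 (h'.tr i hi)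
  refine ⟨fun i hi => ?_, fun i h1 h2 => (key i h1 h2).2⟩
  rcases lt_or_ge i k with h1 | h1
  · rw [h.lo i h1, h'.lo i h1, hfg i hi]
  · exact (key i h1 hi).1

theorem rows_main {f f1 f2 f3 g1 g2 g3 : ℕ → List ℤ} {x y z : ℕ} {Pa Qa Pb Qb Pc Qc Da Ea Db Eb Dc Ec : ℕ → ℤ}
    (hx : 0 < x) (hxy : x ≤ y) (hyz : y < z) (hG : Good f)
    (A : Ins f x f1 Pa Qa) (B : Ins f1 z f2 Pb Qb) (C : Ins f2 y f3 Pc Qc)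
    (A' : Ins f z g1 Da Ea) (B' : Ins g1 x g2 Db Eb) (C' : Ins g2 y g3 Dc Ec) :
    ∀ i, f3 i = g3 i := by
  have hy : 0 < y := by omega
  have hz : 0 < z := by omega
  have G1 := A.good hx hG
  have G2 := B.good hz G1
  have H1 := A'.good hz hG
  have H2 := B'.good hx H1
  have e1 : ∀ i, i < z → f i = g1 i := fun i hi => (A'.lo i hi).symm
  obtain ⟨e2, eab⟩ := Ins_det A B' e1
  have e3 : ∀ i, i < z → f2 i = g2 i := fun i hi => (B.lo i hi).trans (e2 i hi)
  obtain ⟨e4, ecc⟩ := Ins_det C C' e3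
  have ew : ∀ i, i < z → wd f2 i = wd f1 i := wd_congr B.lo
  have pair : ∀ i, y ≤ i → i < z → Pc i ≤ Qa i := by
    intro i hi
    induction i, hi using Nat.le_induction with
    | base =>
      intro h
      have h1 := C.fl
      obtain ⟨h2, h3⟩ := A.step hx hG y hxy
      rw [ew _ h, h3] at h1
      by_contra hh
      have := h1.1 (Qa y) (by omega)
      rw [(mv_facts _ _ _).1] at this
      have := h2.2.1
      omega
    | succ i hi ih =>
      intro h
      obtain ⟨h2, h3⟩ := A.step hx hG i (by omega)
      obtain ⟨h4, h5⟩ := C.step hy G2 i hi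
      have h6 := C.tr i hi
      rw [ew i (by omega), h3] at h4 h6
      rw [B.lo _ h] at h6
      exact Tr_pair (hG i) h2 h4 (A.tr i (by omega)) h6 (ih (by omega))
  have key : ∀ i, z ≤ i → f3 i = g3 i ∧
      Rel (Pa i) (Qa i) (Pb i) (Qb i) (Pc i) (Qc i) (Da i) (Ea i) (Db i) (Eb i) (Dc i) (Ec i) := by
    intro i hi
    induction i, hi using Nat.le_induction with
    | base =>
      obtain ⟨w, rfl⟩ : ∃ w, z = w + 1 := ⟨z - 1, by omega⟩
      have hyw : y ≤ w := by omega
      obtain ⟨h2, h3⟩ := A.step hx hG w (by omega)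
      obtain ⟨h4, h5⟩ := C.step hy G2 w hyw
      obtain ⟨k2, k3⟩ := A.step hx hG (w+1) (by omega)
      have tA := A.tr w (by omega)
      have tC := C.tr w hyw
      have tB' := B'.tr w (by omega)
      have tC' := C'.tr w hyw
      rw [ew w (by omega), h3] at h4
      rw [ew w (by omega), h3, B.row] at tC
      have q1 : wd g1 w = wd f w := (wd_congr e1 w (by omega)).symm
      have q2 : wd g2 w = wd f2 w := (wd_congr e3 w (by omega)).symm
      obtain ⟨q3, q4⟩ := eab w (by omega) (by omega)
      obtain ⟨q5, q6⟩ := ecc w (by omega) (by omega)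
      rw [q1, ← q3, ← q4, A'.row] at tB'
      obtain ⟨l1, m1, P1, Q1, hl, t1, t2⟩ := Tr_append tB'
      obtain ⟨rfl, rfl, rfl⟩ := Tr_det tA t1
      obtain ⟨j', l'', P2, Q2, rfl, hS, rfl, p3, p4⟩ := t2
      rw [← p3, ← p4] at hS
      rw [q2, ew w (by omega), h3, ← q5, ← q6, hl] at tC'
      obtain ⟨l2, m2, P4, Q4, hl2, t3, t4⟩ := Tr_append tC'
      obtain ⟨l3, m3, P5, Q5, hl3, t5, t6⟩ := Tr_append tC
      obtain ⟨rfl, rfl, rfl⟩ := Tr_det t3 t5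
      obtain ⟨j3, l3', P6, Q6, rfl, hS3, rfl, p5, p6⟩ := t4
      obtain ⟨j4, l4', P7, Q7, rfl, hS4, rfl, p7, p8⟩ := t6
      rw [← p5, ← p6] at hS3
      rw [← p7, ← p8] at hS4
      have hp := Tr_pair (hG w) h2 h4 tA t3 (pair w hyw (by omega))
      obtain ⟨r1, r2, r3⟩ := Tr_single h2 (hG w) tA
      obtain ⟨s1, s2, s3⟩ := Tr_single h4 r2 t3
      rw [r3] at s1 hS3 hS4
      have F0 := A'.fl
      have F1 := B.fl
      rw [k3] at F1
      change Step (wd f (w+1)) _ _ _ _ _ _ at hS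
      change Step (mvW (wd f (w+1)) _ _) _ _ _ _ _ _ at hS3
      change Step (mvW (wd f (w+1)) _ _) _ _ _ _ _ _ at hS4
      have := clash (l := min (min (Da (w+1)) (Pb (w+1))) P4 - 1) k2 s1 (F0.1 _ (by omega)) (by omega) hp
        ⟨by omega, F0.2, fun t _ ht => F0.1 t ht⟩ ⟨by omega, F1.2, fun t _ ht => F1.1 t ht⟩ hS4 hS hS3
      obtain ⟨rfl, hR⟩ := this
      refine ⟨by rw [hl2, hl3], ?_⟩
      rw [A'.q, B.q]
      exact hR
    | succ i hi ih =>
      obtain ⟨-, hR⟩ := ih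
      obtain ⟨a1, a2⟩ := A.step hx hG i (by omega)
      obtain ⟨b1, b2⟩ := B.step hz G1 i (by omega)
      obtain ⟨c1, c2⟩ := C.step hy G2 i (by omega)
      obtain ⟨a1', a2'⟩ := A'.step hz hG i (by omega)
      obtain ⟨b1', b2'⟩ := B'.step hx H1 i (by omega)
      obtain ⟨c1', c2'⟩ := C'.step hy H2 i (by omega)
      have tA := A.tr i (by omega)
      have tB := B.tr i (by omega)
      have tC := C.tr i (by omega)
      have tA' := A'.tr i (by omega)
      have tB' := B'.tr i (by omega)
      have tC' := C'.tr i (by omega)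
      rw [b2, a2] at c1 tC
      rw [a2] at b1 tB
      rw [b2', a2'] at c1' tC'
      rw [a2'] at b1' tB'
      exact Tr_triple (hG i) a1 b1 c1 a1' b1' c1' tA tB tC hR tA' tB' tC'
  intro i
  rcases lt_or_ge i z with h | h
  · exact e4 i h
  · exact (key i h).1


/-- ascending word -/
def AscO (W : ℤ → ℤ) : List ℤ → Prop
  | [] => True
  | j :: l => W j < W (j + 1) ∧ AscO (swW W j) l

theorem AscO_append (W : ℤ → ℤ) (l m : List ℤ) : AscO W (l ++ m) ↔ AscO W l ∧ AscO (run W l) m := by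
  induction l generalizing W with
  | nil => simp [AscO, run]
  | cons j l ih => simp only [List.cons_append, AscO, run, ih, and_assoc]

theorem Asc.ascO {W : ℤ → ℤ} {l : List ℤ} (h : Asc W l) : AscO W l := by
  induction l generalizing W with
  | nil => trivial
  | cons j l ih => exact ⟨h.1.1, ih h.2⟩

theorem sj_sj (j t : ℤ) : sj j (sj j t) = t := by
  simp only [sj]; split_ifs <;> omega

theorem sj_inj {j a b : ℤ} : sj j a = sj j b ↔ a = b :=
  ⟨fun h => by rw [← sj_sj j a, h, sj_sj], fun h => by rw [h]⟩

theorem swW_swW (W : ℤ → ℤ) (j : ℤ) : swW (swW W j) j = W := by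
  funext t; simp only [swW, sj_sj]

theorem sT_apply (j t : ℤ) : sT j t = sj j t := by
  simp only [sT, Equiv.swap_apply_def, sj]

theorem swW_inj {W : ℤ → ℤ} (h : Function.Injective W) (j : ℤ) : Function.Injective (swW W j) := by
  intro a b hab
  have := h hab
  rw [← sj_sj j a, this, sj_sj]

theorem run_inj {W : ℤ → ℤ} (h : Function.Injective W) (l : List ℤ) : Function.Injective (run W l) := by
  induction l generalizing W with
  | nil => exact h
  | cons j l ih => exact ih (swW_inj h j)

theorem run_prod (W : ℤ → ℤ) (l : List ℤ) (t : ℤ) : run W l t = W ((l.map sT).prod t) := by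
  induction l generalizing W with
  | nil => rfl
  | cons j l ih =>
    simp only [run, ih, List.map_cons, List.prod_cons, Equiv.Perm.mul_apply, sT_apply, swW]

theorem mv_adj (W : ℤ → ℤ) (j : ℤ) : mvW W j (j + 1) = swW W j := by
  funext t; simp only [mvW, swW, sj]

theorem mv_adj' (W : ℤ → ℤ) (j : ℤ) : mvW W (j + 1) j = swW W j := by
  funext t; simp only [mvW, swW, sj]; congr 1; split_ifs <;> omega

theorem deletion (l : List ℤ) : ∀ x y, x < y → run id l y < run id l x →
    ∃ l2 : List ℤ, l2.length + 1 = l.length ∧ run id l2 = mvW (run id l) x y := by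
  induction l using List.reverseRecOn with
  | nil => intro x y h h'; simp only [run, id] at h'; omega
  | append_singleton l0 j ih =>
    intro x y h h'
    rw [run_append] at h' ⊢
    change swW (run id l0) j y < swW (run id l0) j x at h'
    change ∃ l2 : List ℤ, _ ∧ _ = mvW (swW (run id l0) j) x y
    by_cases hc : x = j ∧ y = j + 1
    · obtain ⟨rfl, rfl⟩ := hc
      exact ⟨l0, by simp, by rw [mv_adj, swW_swW]⟩
    · obtain ⟨l2, h1, h2⟩ := ih (sj j x) (sj j y) (by simp only [sj]; split_ifs <;> omega) h'
      refine ⟨l2 ++ [j], by simp [h1], ?_⟩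
      rw [run_append, h2]
      show swW _ j = _
      funext t
      simp only [swW, mvW]
      congr 1
      simp only [sj_inj]; split_ifs <;> rfl

theorem asc_min (l : List ℤ) (h : AscO id l) : ∀ l', run id l' = run id l → l.length ≤ l'.length := by
  induction l using List.reverseRecOn with
  | nil => intro l' _; simp
  | append_singleton l0 j ih =>
    intro l' hl
    rw [AscO_append] at h
    rw [run_append] at hl
    change _ = swW (run id l0) j at hl
    obtain ⟨l2, h1, h2⟩ := deletion l' j (j + 1) (by omega) (by
      rw [hl]
      have := h.2.1
      simpa [swW, sj] using this)
    rw [hl, mv_adj, swW_swW] at h2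
    have := ih h.1 l2 h2
    simp; omega

theorem not_asc {W : ℤ → ℤ} {l : List ℤ} (h : ¬ AscO W l) :
    ∃ l0 j l1, l = l0 ++ j :: l1 ∧ ¬ run W l0 j < run W l0 (j + 1) := by
  induction l generalizing W with
  | nil => exact absurd trivial h
  | cons j l ih =>
    by_cases h1 : W j < W (j + 1)
    · obtain ⟨l0, c, l1, rfl, h2⟩ := ih (W := swW W j) (fun h2 => h ⟨h1, h2⟩)
      exact ⟨j :: l0, c, l1, rfl, h2⟩
    · exact ⟨[], j, l, rfl, h1⟩

theorem not_asc_short (l : List ℤ) (h : ¬ AscO id l) : ∃ l', run id l' = run id l ∧ l'.length < l.length := by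
  obtain ⟨l0, j, l1, rfl, h⟩ := not_asc h
  have hne : run id l0 j ≠ run id l0 (j + 1) := fun h => by
    have := run_inj Function.injective_id l0 h; omega
  obtain ⟨l2, h1, h2⟩ := deletion l0 j (j + 1) (by omega) (by omega)
  refine ⟨l2 ++ l1, ?_, by simp; omega⟩
  rw [run_append, run_append, h2, mv_adj]
  rfl

theorem prod_reverse (l : List ℤ) : (l.reverse.map sT).prod = ((l.map sT).prod)⁻¹ := by
  induction l with
  | nil => simp
  | cons j l ih =>
    rw [List.reverse_cons, List.map_append, List.prod_append, ih]
    simp [sT]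

/-- the length of a product is the length of the word iff the word is ascending -/
theorem len_iff (l : List ℤ) : len ((l.reverse.map sT).prod) = l.length ↔ AscO id l := by
  have key : ∀ l' : List ℤ, (l'.map sT).prod = (l.reverse.map sT).prod ↔ run id l'.reverse = run id l := by
    intro l'
    constructor
    · intro h
      funext t
      rw [run_prod, run_prod, prod_reverse, h, prod_reverse, inv_inv]
    · intro h
      have : (l'.reverse.map sT).prod = (l.map sT).prod := by
        ext t
        have := congrFun h t
        rw [run_prod, run_prod] at this
        exact this
      rw [prod_reverse] at this ⊢
      rw [← this, inv_inv]
  unfold len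
  constructor
  · intro h
    by_contra hn
    obtain ⟨l', h1, h2⟩ := not_asc_short l hn
    have hm : l'.length ∈ {m : ℕ | ∃ l0 : List ℤ, l0.length = m ∧ (l0.map sT).prod = (l.reverse.map sT).prod} :=
      ⟨l'.reverse, by simp, (key _).2 (by simpa using h1)⟩
    have := Nat.sInf_le hm
    omega
  · intro h
    apply le_antisymm
    · exact Nat.sInf_le ⟨l.reverse, by simp, rfl⟩
    · refine le_csInf (s := {m : ℕ | ∃ l0 : List ℤ, l0.length = m ∧
        (l0.map sT).prod = (l.reverse.map sT).prod}) ⟨l.length, l.reverse, by simp, rfl⟩ ?_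
      rintro m ⟨l', rfl, h'⟩
      have := asc_min l h _ ((key l').1 h')
      simpa using this

/-- an inversion of labels -/
def Invd (V : ℤ → ℤ) (A B : ℤ) : Prop := ∃ x y, x < y ∧ V x = A ∧ V y = B

theorem Invd_run {V : ℤ → ℤ} {A B : ℤ} (hAB : B < A) {l : List ℤ} (hl : AscO V l) (h : Invd V A B) :
    Invd (run V l) A B := by
  induction l generalizing V with
  | nil => exact h
  | cons j l ih =>
    apply ih hl.2
    obtain ⟨x, y, h1, h2, h3⟩ := h
    have hj := hl.1
    refine ⟨sj j x, sj j y, ?_, by simp only [swW, sj_sj, h2], by simp only [swW, sj_sj, h3]⟩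
    have : ¬ (x = j ∧ y = j + 1) := by
      rintro ⟨rfl, rfl⟩; omega
    simp only [sj]; split_ifs <;> omega

theorem Invd_no {V : ℤ → ℤ} {A B c : ℤ} (hV : Function.Injective V) (h : Invd V A B)
    (h1 : V (c + 1) = A) (h2 : V c = B) : False := by
  obtain ⟨x, y, hxy, hx, hy⟩ := h
  have := hV (h1.trans hx.symm)
  have := hV (h2.trans hy.symm)
  omega

theorem run_comp (τ : ℤ → ℤ) (W : ℤ → ℤ) (l : List ℤ) : run (τ ∘ W) l = τ ∘ run W l := by
  induction l generalizing W with
  | nil => rfl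
  | cons j l ih => exact ih (swW W j)

theorem run_lo {W : ℤ → ℤ} {l : List ℤ} {t : ℤ} (h : ∀ c ∈ l, t < c) : run W l t = W t := by
  induction l generalizing W with
  | nil => rfl
  | cons j l ih =>
    have h1 := h j (by simp)
    rw [run, ih (fun c hc => h c (by simp [hc])), swW, sj_far (by omega) (by omega)]

theorem run_hi {W : ℤ → ℤ} {l : List ℤ} {t : ℤ} (h : ∀ c ∈ l, c + 1 < t) : run W l t = W t := by
  induction l generalizing W with
  | nil => rfl
  | cons j l ih =>
    have h1 := h j (by simp)
    rw [run, ih (fun c hc => h c (by simp [hc])), swW, sj_far (by omega) (by omega)]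


theorem eq_of_pw {α : Type*} {r : α → α → Prop} (hr : ∀ a b, r a b → r b a → False)
    {l l' : List α} (h : l.Pairwise r) (h' : l'.Pairwise r) (hm : ∀ a, a ∈ l ↔ a ∈ l') : l = l' := by
  have hne : ∀ a b, r a b → a ≠ b := fun a b h1 h2 => by subst h2; exact hr _ _ h1 h1
  have hp : l.Perm l' := (List.perm_ext_iff_of_nodup (h.imp (fun {a b} => hne a b))
    (h'.imp (fun {a b} => hne a b))).2 hm
  exact hp.eq_of_pairwise (fun a b _ _ h1 h2 => (hr a b h1 h2).elim) h h'

/-- the row `k` as a strictly decreasing list of indices -/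
def rl (n : ℕ) (R : Finset (ℤ × ℤ)) (k : ℕ) : List ℤ :=
  ((R.filter fun p => p.2 = (k : ℤ)).image fun p : ℤ × ℤ => (p.1 + p.2 - (n : ℤ) - 1 : ℤ)).sort (· ≥ ·)

theorem rl_pw (n : ℕ) (R : Finset (ℤ × ℤ)) (k : ℕ) : (rl n R k).Pairwise (· > ·) :=
  (Finset.sortedGT_sort _).pairwise

theorem mem_rl {n : ℕ} {R : Finset (ℤ × ℤ)} {k : ℕ} {j : ℤ} :
    j ∈ rl n R k ↔ (j + n + 1 - k, (k : ℤ)) ∈ R := by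
  unfold rl
  rw [Finset.mem_sort, Finset.mem_image]
  constructor
  · rintro ⟨⟨a, b⟩, h1, h2⟩
    rw [Finset.mem_filter] at h1
    obtain ⟨h1, h3⟩ := h1
    simp only at h2 h3
    subst h3
    have : j + n + 1 - (k : ℤ) = a := by omega
    rw [this]; exact h1
  · intro h
    exact ⟨_, Finset.mem_filter.2 ⟨h, rfl⟩, by simp; omega⟩

theorem rl_eq {n : ℕ} {R : Finset (ℤ × ℤ)} {k : ℕ} {l : List ℤ} (h : l.Pairwise (· > ·))
    (hm : ∀ j, j ∈ l ↔ (j + n + 1 - k, (k : ℤ)) ∈ R) : rl n R k = l :=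
  eq_of_pw (fun a b h1 h2 => by omega) (rl_pw n R k) h fun a => mem_rl.trans (hm a).symm

def Gr (n : ℕ) (R : Finset (ℤ × ℤ)) : Prop := ∀ p ∈ R, p.1 ≤ n ∧ 1 ≤ p.2 ∧ p.2 ≤ n

theorem Gr.ext {n : ℕ} {R S : Finset (ℤ × ℤ)} (hR : Gr n R) (hS : Gr n S)
    (h : ∀ k, rl n R k = rl n S k) : R = S := by
  have key : ∀ {R S : Finset (ℤ × ℤ)}, Gr n R → (∀ k, rl n R k = rl n S k) → R ⊆ S := by
    intro R S hR h p hp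
    obtain ⟨h1, h2, h3⟩ := hR p hp
    obtain ⟨a, b⟩ := p
    simp only at h1 h2 h3
    lift b to ℕ using by omega
    have : a + b - n - 1 ∈ rl n R b := by
      rw [mem_rl]; convert hp using 2; ring
    rw [h, mem_rl] at this
    convert this using 2; ring
  exact Finset.Subset.antisymm (key hR h) (key hS fun k => (h k).symm)

theorem rl_lt {n : ℕ} {R : Finset (ℤ × ℤ)} (hR : Gr n R) {k : ℕ} {j : ℤ} (h : j ∈ rl n R k) : j < k := by
  have := (hR _ (mem_rl.1 h)).1
  simp only at this
  omega

theorem rl_zero {n : ℕ} {R : Finset (ℤ × ℤ)} (hR : Gr n R) : rl n R 0 = [] := by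
  rw [List.eq_nil_iff_forall_not_mem]
  intro a h
  have := (hR _ (mem_rl.1 h)).2.1
  simp at this

theorem rl_big {n : ℕ} {R : Finset (ℤ × ℤ)} (hR : Gr n R) {k : ℕ} (hk : n < k) : rl n R k = [] := by
  rw [List.eq_nil_iff_forall_not_mem]
  intro a h
  have := (hR _ (mem_rl.1 h)).2.2
  simp at this
  omega

/-- chronological list of cells in the rows `1..m` -/
def alc (n : ℕ) (R : Finset (ℤ × ℤ)) : ℕ → List (ℤ × ℤ)
  | 0 => []
  | m + 1 => alc n R m ++ (rl n R (m + 1)).map fun j : ℤ => ((j + (n : ℤ) + 1 - ((m + 1 : ℕ) : ℤ) : ℤ), ((m + 1 : ℕ) : ℤ))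

def al (f : ℕ → List ℤ) : ℕ → List ℤ
  | 0 => []
  | m + 1 => al f m ++ f (m + 1)

theorem run_al (f : ℕ → List ℤ) (m : ℕ) : run id (al f m) = wd f m := by
  induction m with
  | zero => rfl
  | succ m ih => rw [al, run_append, ih]; rfl

theorem AscO_al (f : ℕ → List ℤ) (m : ℕ) : AscO id (al f m) ↔ ∀ k, k < m → AscO (wd f k) (f (k + 1)) := by
  induction m with
  | zero => simp [al, AscO]
  | succ m ih =>
    rw [al, AscO_append, ih, run_al]
    constructor
    · rintro ⟨h1, h2⟩ k hk
      rcases eq_or_lt_of_le (show k ≤ m by omega) with h | h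
      · rw [h]; exact h2
      · exact h1 k h
    · intro h
      exact ⟨fun k hk => h k (by omega), h m (by omega)⟩

theorem mem_alc {n : ℕ} {R : Finset (ℤ × ℤ)} {m : ℕ} {p : ℤ × ℤ} :
    p ∈ alc n R m ↔ p ∈ R ∧ 1 ≤ p.2 ∧ p.2 ≤ m := by
  induction m with
  | zero => simp [alc]; intros; omega
  | succ m ih =>
    rw [alc, List.mem_append, ih, List.mem_map]
    constructor
    · rintro (h | ⟨j, h, rfl⟩)
      · exact ⟨h.1, h.2.1, by push_cast; omega⟩
      · exact ⟨mem_rl.1 h, by simp, by simp⟩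
    · rintro ⟨h1, h2, h3⟩
      by_cases h : p.2 ≤ m
      · exact Or.inl ⟨h1, h2, h⟩
      · right
        obtain ⟨a, b⟩ := p
        simp only at h h2 h3
        obtain rfl : b = ((m + 1 : ℕ) : ℤ) := by push_cast at h3 ⊢; omega
        refine ⟨a + (m + 1 : ℕ) - n - 1, mem_rl.2 ?_, ?_⟩
        · convert h1 using 2; ring
        · ext <;> simp <;> ring

theorem alc_pw (n : ℕ) (R : Finset (ℤ × ℤ)) (m : ℕ) :
    (alc n R m).Pairwise (fun p q => p.2 < q.2 ∨ (p.2 = q.2 ∧ q.1 < p.1)) := by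
  induction m with
  | zero => simp [alc]
  | succ m ih =>
    rw [alc, List.pairwise_append]
    refine ⟨ih, ?_, ?_⟩
    · rw [List.pairwise_map]
      exact (rl_pw n R (m + 1)).imp fun {a b} h => Or.inr ⟨rfl, by simp only; omega⟩
    · intro a ha b hb
      rw [mem_alc] at ha
      rw [List.mem_map] at hb
      obtain ⟨j, _, rfl⟩ := hb
      left; simp only; push_cast; omega

theorem alc_map (n : ℕ) (R : Finset (ℤ × ℤ)) (m : ℕ) :
    (alc n R m).map (fun p : ℤ × ℤ => (p.1 + p.2 - (n : ℤ) - 1 : ℤ)) = al (rl n R) m := by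
  induction m with
  | zero => rfl
  | succ m ih =>
    rw [alc, al, List.map_append, ih, List.map_map]
    congr 1
    conv_rhs => rw [← List.map_id (rl n R (m + 1))]
    apply List.map_congr_left
    intro a _
    simp only [Function.comp, id]; ring

theorem sort_pw (R : Finset (ℤ × ℤ)) :
    (R.sort rcOrder).Pairwise (fun q p => p.2 < q.2 ∨ (p.2 = q.2 ∧ q.1 < p.1)) := by
  have h1 := Finset.pairwise_sort R rcOrder
  have h2 : (R.sort rcOrder).Pairwise (· ≠ ·) := Finset.sort_nodup R rcOrder
  refine (h1.and h2).imp ?_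
  rintro ⟨a, b⟩ ⟨c, d⟩ ⟨h, h'⟩
  simp only [rcOrder] at h
  simp only [ne_eq, Prod.mk.injEq] at h'
  simp only
  omega

theorem sort_eq_alc {n : ℕ} {R : Finset (ℤ × ℤ)} (hR : Gr n R) :
    R.sort rcOrder = (alc n R n).reverse := by
  refine eq_of_pw (r := fun q p => p.2 < q.2 ∨ (p.2 = q.2 ∧ q.1 < p.1)) (fun a b h1 h2 => by omega)
    (sort_pw R) (List.pairwise_reverse.2 (alc_pw n R n)) fun a => ?_
  rw [Finset.mem_sort, List.mem_reverse, mem_alc]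
  exact ⟨fun h => ⟨h, (hR a h).2⟩, fun h => h.1⟩

theorem IsRC_general (n : ℕ) (R : Finset (ℤ × ℤ)) :
    len (wR n R) = R.card ↔ AscO id ((R.sort rcOrder).reverse.map fun p : ℤ × ℤ => (p.1 + p.2 - (n : ℤ) - 1 : ℤ)) := by
  rw [← len_iff, ← List.map_reverse, List.reverse_reverse, List.map_map]
  simp [wR, Function.comp_def]

theorem IsRC_iff {n : ℕ} {R : Finset (ℤ × ℤ)} (hR : Gr n R) :
    IsRC n R ↔ ∀ k, AscO (wd (rl n R) k) (rl n R (k + 1)) := by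
  unfold IsRC
  rw [IsRC_general, sort_eq_alc hR, List.reverse_reverse, alc_map, AscO_al]
  constructor
  · rintro ⟨-, h⟩ k
    by_cases hk : k < n
    · exact h k hk
    · rw [rl_big hR (by omega)]; trivial
  · intro h
    exact ⟨fun p hp => ⟨(hR p hp).1, (hR p hp).2.2⟩, fun k _ => h k⟩

theorem Asc_of_star {W : ℤ → ℤ} {l : List ℤ} (hA : AscO W l)
    (hst : ∀ A B, B < A → A ≤ 0 → ¬ Invd (run W l) A B) : Asc W l := by
  induction l generalizing W with
  | nil => trivial
  | cons j l ih =>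
    refine ⟨⟨hA.1, ?_⟩, ih hA.2 hst⟩
    by_contra hn
    refine hst (W (j + 1)) (W j) hA.1 (by omega) (Invd_run (V := swW W j) hA.1 hA.2 ⟨j, j + 1, by omega, ?_, ?_⟩)
    · simp [swW, sj]
    · simp [swW, sj]

theorem Asc_al (f : ℕ → List ℤ) (m : ℕ) : Asc id (al f m) ↔ ∀ k, k < m → Asc (wd f k) (f (k + 1)) := by
  induction m with
  | zero => simp [al, Asc]
  | succ m ih =>
    rw [al, Asc_append, ih, run_al]
    constructor
    · rintro ⟨h1, h2⟩ k hk
      rcases eq_or_lt_of_le (show k ≤ m by omega) with h | h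
      · rw [h]; exact h2
      · exact h1 k h
    · intro h
      exact ⟨fun k hk => h k (by omega), h m (by omega)⟩

theorem star_good {n : ℕ} {R : Finset (ℤ × ℤ)} (hR : IsRC n R) (hS : Star n R) :
    Gr n R ∧ Good (rl n R) := by
  obtain ⟨hgrid, hlen⟩ := hR
  rw [IsRC_general] at hlen
  have hmono : ∀ a b : ℤ, a < b → b ≤ 0 → wR n R a < wR n R b := by
    intro a b hab
    induction b, (show a + 1 ≤ b by omega) using Int.leInduction with
    | base => intro h; simpa using hS (a + 1) h
    | succ b hb ih =>
      intro h
      have h1 := ih (by omega) (by omega)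
      have h2 := hS (b + 1) h
      simp only [add_sub_cancel_right] at h2
      omega
  have hrun : ∀ t, run id ((R.sort rcOrder).reverse.map fun p : ℤ × ℤ => (p.1 + p.2 - (n : ℤ) - 1 : ℤ)) t = (wR n R)⁻¹ t := by
    intro t
    rw [run_prod, List.map_reverse, prod_reverse, List.map_map]
    rfl
  have hA := Asc_of_star hlen (by
    rintro A B hBA hA ⟨x, y, hxy, hx, hy⟩
    rw [hrun, Equiv.Perm.inv_eq_iff_eq] at hx hy
    have := hmono B A hBA hA
    omega)
  have hGr : Gr n R := by
    have hpw : ((R.sort rcOrder).reverse).Pairwise _ := List.pairwise_reverse.2 (sort_pw R)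
    have hmem : ∀ p, p ∈ (R.sort rcOrder).reverse ↔ p ∈ R := by simp
    intro p hp
    refine ⟨(hgrid p hp).1, ?_, (hgrid p hp).2⟩
    have hp' := (hmem p).2 hp
    generalize (R.sort rcOrder).reverse = L at *
    match L with
    | [] => simp at hp'
    | q :: L =>
      have h1 := hA.1.2
      simp only [id] at h1
      have h2 := (hgrid q ((hmem q).1 (by simp))).1
      rw [List.pairwise_cons] at hpw
      rcases List.mem_cons.1 hp' with rfl | h
      · omega
      · have := hpw.1 p h
        omega
  refine ⟨hGr, fun k => ?_⟩
  rw [sort_eq_alc hGr, List.reverse_reverse, alc_map, Asc_al] at hA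
  by_cases hk : k < n
  · exact hA k hk
  · rw [rl_big hGr (by omega)]; trivial


theorem dec_mem {l : List ℤ} (h : l.Pairwise (· > ·)) {j : ℤ} (hj : j ∈ l) :
    l = l.filter (fun c => j < c) ++ j :: l.filter (fun c => c < j) := by
  refine eq_of_pw (r := (· > ·)) (fun a b h1 h2 => by omega) h ?_ ?_
  · rw [List.pairwise_append, List.pairwise_cons]
    refine ⟨h.filter _, ⟨?_, h.filter _⟩, ?_⟩
    · intro a ha; simp at ha; exact ha.2
    · intro a ha b hb
      simp at ha hb
      omega
  · intro a
    simp
    constructor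
    · intro ha
      rcases lt_trichotomy j a with h1 | h1 | h1
      · exact Or.inl ⟨ha, h1⟩
      · exact Or.inr (Or.inl h1.symm)
      · exact Or.inr (Or.inr ⟨ha, h1⟩)
    · rintro (h1 | rfl | h1)
      · exact h1.1
      · exact hj
      · exact h1.1

theorem dec_not {l : List ℤ} (h : l.Pairwise (· > ·)) {j : ℤ} (hj : j ∉ l) :
    l = l.filter (fun c => j < c) ++ l.filter (fun c => c < j) := by
  refine eq_of_pw (r := (· > ·)) (fun a b h1 h2 => by omega) h ?_ ?_
  · rw [List.pairwise_append]
    refine ⟨h.filter _, h.filter _, ?_⟩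
    intro a ha b hb
    simp at ha hb
    omega
  · intro a
    simp
    constructor
    · intro ha
      rcases lt_trichotomy j a with h1 | h1 | h1
      · exact Or.inl ⟨ha, h1⟩
      · exact absurd (h1 ▸ ha) hj
      · exact Or.inr ⟨ha, h1⟩
    · rintro (h1 | h1)
      · exact h1.1
      · exact h1.1

theorem dec_filter_succ_mem {l : List ℤ} (h : l.Pairwise (· > ·)) {j : ℤ} (hj : j + 1 ∈ l) :
    l.filter (fun c => j < c) = l.filter (fun c => j + 1 < c) ++ [j + 1] := by
  refine eq_of_pw (r := (· > ·)) (fun a b h1 h2 => by omega) (h.filter _) ?_ ?_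
  · rw [List.pairwise_append]
    refine ⟨h.filter _, by simp, ?_⟩
    intro a ha b hb
    simp at ha hb
    omega
  · intro a
    simp
    constructor
    · rintro ⟨h1, h2⟩
      rcases eq_or_ne a (j + 1) with h3 | h3
      · exact Or.inr h3
      · exact Or.inl ⟨h1, by omega⟩
    · rintro (h1 | rfl)
      · exact ⟨h1.1, by omega⟩
      · exact ⟨hj, by omega⟩

theorem dec_filter_succ_not {l : List ℤ} {j : ℤ} (hj : j + 1 ∉ l) :
    l.filter (fun c => j < c) = l.filter (fun c => j + 1 < c) := by
  apply List.filter_congr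
  intro a ha
  have : a ≠ j + 1 := fun h => hj (h ▸ ha)
  simp; omega

theorem wd_hi {n : ℕ} {R : Finset (ℤ × ℤ)} (hR : Gr n R) (k : ℕ) : ∀ t : ℤ, (k : ℤ) < t → wd (rl n R) k t = t := by
  induction k with
  | zero => intro t _; rfl
  | succ k ih =>
    intro t ht
    push_cast at ht
    rw [wd, run_hi, ih t (by omega)]
    intro c hc
    have := rl_lt hR hc
    push_cast at this
    omega

theorem wd_inj (f : ℕ → List ℤ) (k : ℕ) : Function.Injective (wd f k) := by
  induction k with
  | zero => exact Function.injective_id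
  | succ k ih => exact run_inj ih _

theorem wd_low (f : ℕ → List ℤ) (k : ℕ) : ∃ N : ℤ, ∀ t, t < N → wd f k t = t := by
  induction k with
  | zero => exact ⟨0, fun t _ => rfl⟩
  | succ k ih =>
    obtain ⟨N, hN⟩ := ih
    obtain ⟨M, hM⟩ : ∃ M : ℤ, ∀ c ∈ f (k + 1), M ≤ c := by
      generalize f (k + 1) = l
      induction l with
      | nil => exact ⟨0, by simp⟩
      | cons a l ih =>
        obtain ⟨M, hM⟩ := ih
        refine ⟨min M a, ?_⟩
        intro c hc
        rcases List.mem_cons.1 hc with rfl | h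
        · omega
        · have := hM c h; omega
    refine ⟨min N M, fun t ht => ?_⟩
    rw [wd, run_lo, hN t (by omega)]
    intro c hc
    have := hM c hc
    omega

theorem mem_rl' {n : ℕ} {R : Finset (ℤ × ℤ)} {k : ℕ} {j : ℤ} :
    (j + n - k, (k : ℤ) + 1) ∈ R ↔ j ∈ rl n R (k + 1) := by
  rw [mem_rl]
  push_cast
  rw [show j + (n : ℤ) + 1 - ((k : ℤ) + 1) = j + n - k by ring]

theorem lab_true_zero {n : ℕ} {R : Finset (ℤ × ℤ)} (hR : Gr n R) (i : ℤ) (hi : i ≤ n) :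
    lab n R true i 0 = i - n := by
  rw [lab]
  split_ifs with h1 h2
  · omega
  · have := (hR _ h2).2.1; simp at this
  · rw [lab]; simp; ring

theorem lab_main {n : ℕ} {R : Finset (ℤ × ℤ)} (hR : Gr n R) (k : ℕ) :
    (∀ j : ℤ, j ≤ k → lab n R false (j + n - k) (k + 1) = wd (rl n R) k j) ∧
    (∀ j : ℤ, j ≤ k → lab n R true (j + n - k) (k + 1) =
      run (wd (rl n R) k) ((rl n R (k + 1)).filter (fun c => j < c)) (j + 1)) := by
  have hT : ∀ k : ℕ, (∀ j : ℤ, j ≤ k → lab n R false (j + n - k) (k + 1) = wd (rl n R) k j) →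
      (∀ j : ℤ, j ≤ k → lab n R true (j + n - k) (k + 1) =
      run (wd (rl n R) k) ((rl n R (k + 1)).filter (fun c => j < c)) (j + 1)) := by
    intro k hF
    have : ∀ m : ℕ, ∀ j : ℤ, j = k - m → lab n R true (j + n - k) (k + 1) =
      run (wd (rl n R) k) ((rl n R (k + 1)).filter (fun c => j < c)) (j + 1) := by
      intro m
      induction m with
      | zero =>
        intro j hj
        have hj : j = k := by simpa using hj
        subst hj
        have : (rl n R (k + 1)).filter (fun c => (k : ℤ) < c) = [] := by
          rw [List.filter_eq_nil_iff]
          intro c hc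
          have := rl_lt hR hc
          simp; push_cast at this; omega
        rw [this, run, wd_hi hR k _ (by omega), lab]
        simp
      | succ m ih =>
        intro j hj
        have h1 := ih (j + 1) (by push_cast at hj; omega)
        rw [lab, dif_neg (by push_cast at hj; omega)]
        rw [show j + (n : ℤ) - k + 1 = j + 1 + n - k by ring]
        by_cases hm : j + 1 ∈ rl n R (k + 1)
        · rw [if_pos (mem_rl'.2 hm), h1, dec_filter_succ_mem (rl_pw n R _) hm, run_append]
          simp [run, swW, sj]
        · rw [if_neg (fun h => hm (mem_rl'.1 h)), hF (j + 1) (by push_cast at hj; omega),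
            dec_filter_succ_not hm, run_lo]
          intro c hc
          simp at hc
          exact hc.2
    intro j hj
    exact this (k - j).toNat j (by omega)
  have hF : ∀ j : ℤ, j ≤ k → lab n R false (j + n - k) (k + 1) = wd (rl n R) k j := by
    induction k with
    | zero =>
      intro j hj
      have h0 : ¬ ((j + (n : ℤ) - (0 : ℕ), (0 : ℤ)) ∈ R) := by
        intro h2
        have := (hR _ h2).2.1; simp at this
      rw [lab, dif_neg (by simp)]
      simp only [Nat.cast_zero, zero_add, sub_self, sub_zero] at h0 ⊢
      rw [if_neg h0, lab_true_zero hR _ (by simpa using hj)]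
      simp [wd]
    | succ k ih =>
      intro j hj
      have ihT := hT k ih
      push_cast at hj ⊢
      rw [lab, dif_neg (by omega)]
      have e1 : j + (n : ℤ) - (k + 1) = (j - 1) + n - k := by ring
      have e2 : (k : ℤ) + 1 + 1 - 1 = k + 1 := by ring
      rw [e1, e2]
      have hlow : ∀ c ∈ (rl n R (k + 1)).filter (fun c => c < j - 1), c + 1 < j := by
        intro c hc
        simp at hc
        omega
      by_cases hm : j - 1 ∈ rl n R (k + 1)
      · rw [if_pos (mem_rl'.2 hm), ih _ (by omega), wd, dec_mem (rl_pw n R (k + 1)) hm, run_append, run,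
          run_hi hlow, swW]
        rw [show sj (j - 1) j = j - 1 by simp [sj], run_lo]
        intro c hc
        simp at hc
        omega
      · rw [if_neg (fun h => hm (mem_rl'.1 h)), ihT _ (by omega), wd]
        conv_rhs => rw [dec_not (rl_pw n R (k + 1)) hm]
        rw [run_append, run_hi hlow, sub_add_cancel]
  exact ⟨hF, hT k hF⟩


theorem mv_tau {W : ℤ → ℤ} (hW : Function.Injective W) (P Q : ℤ) :
    mvW W P Q = (fun t => Equiv.swap (W P) (W Q) t) ∘ W := by
  funext t
  simp only [mvW, Function.comp, Equiv.swap_apply_def, hW.eq_iff]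
  split_ifs <;> rfl

theorem Tr_dich {W : ℤ → ℤ} {P Q : ℤ} (l : List ℤ) :
    (∃ P' Q', Tr W P Q l l P' Q' ∧ run W l P' = W P ∧ run W l Q' = W Q) ∨
    ∃ pre j post, l = pre ++ j :: post ∧ Tr W P Q pre pre (j + 1) j ∧
      run W pre (j + 1) = W P ∧ run W pre j = W Q := by
  induction l generalizing W P Q with
  | nil => exact Or.inl ⟨P, Q, ⟨rfl, rfl, rfl⟩, rfl, rfl⟩
  | cons a l ih =>
    by_cases h : Q = a ∧ P = a + 1
    · obtain ⟨rfl, rfl⟩ := h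
      exact Or.inr ⟨[], Q, l, rfl, ⟨rfl, rfl, rfl⟩, rfl, rfl⟩
    · have hS : Step W a P Q a (sj a P) (sj a Q) := Or.inl ⟨h, rfl, rfl, rfl⟩
      rcases ih (W := swW W a) (P := sj a P) (Q := sj a Q) with
        ⟨P', Q', hT, h1, h2⟩ | ⟨pre, j, post, rfl, hT, h1, h2⟩
      · refine Or.inl ⟨P', Q', ⟨a, l, _, _, rfl, hS, hT⟩, ?_, ?_⟩
        · rw [run, h1, swW, sj_sj]
        · rw [run, h2, swW, sj_sj]
      · refine Or.inr ⟨a :: pre, j, post, rfl, ⟨a, pre, _, _, rfl, hS, hT⟩, ?_, ?_⟩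
        · rw [run, h1, swW, sj_sj]
        · rw [run, h2, swW, sj_sj]

theorem least_pos {V : ℤ → ℤ} {j t : ℤ} (h1 : j < t) (h2 : 0 < V t) : ∃ r, LL V j r ∧ r ≤ t := by
  obtain ⟨r, hr, hm⟩ := Int.exists_least_of_bdd (P := fun t => j < t ∧ 0 < V t) ⟨j, fun z hz => hz.1.le⟩ ⟨t, h1, h2⟩
  refine ⟨r, ⟨hr.1, hr.2, fun s s1 s2 => ?_⟩, hm t ⟨h1, h2⟩⟩
  by_contra hc
  have := hm s ⟨s1, by omega⟩
  omega

theorem LL_exists {W : ℤ → ℤ} {P Q j k : ℤ} {pre : List ℤ} (hC : Cov W P Q) (hA : Asc W pre)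
    (hk : 0 < W (k + 1)) (hP : P ≤ k) (hpw : pre.Pairwise (· > ·)) (hlt : ∀ c ∈ pre, j < c ∧ c ≤ k)
    (hT : Tr W P Q pre pre (j + 1) j) :
    ∃ r, LL (run W pre) (j + 1) r ∧ r ≤ k + 1 ∧ ∀ c ∈ pre, r ≤ c := by
  rcases List.eq_nil_or_concat pre with rfl | ⟨pre0, c, rfl⟩
  · obtain ⟨-, rfl, rfl⟩ := hT
    obtain ⟨r, hr, hr'⟩ := least_pos (V := W) (j := j + 1) (t := k + 1) (by omega) hk
    exact ⟨r, hr, hr', by simp⟩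
  · rw [List.concat_eq_append] at *
    rw [Asc_append] at hA
    obtain ⟨l1, m1, P1, Q1, he, hT1, hT2⟩ := Tr_append hT
    obtain ⟨c1, -, -⟩ := Tr_single hC hA.1 hT1
    obtain ⟨j', l'', P2, Q2, rfl, hS, h1, rfl, rfl⟩ := hT2
    have hU : Up (run W pre0) c := hA.2.1
    have hcj := hlt c (by simp)
    have hne : c ≠ j + 1 := by
      rintro rfl
      rcases hS with ⟨-, -, h3, h4⟩ | ⟨-, -, ⟨h3, -, -⟩, -, -⟩
      · have e1 : P1 = j + 1 + 1 := by
          have := congrArg (sj (j + 1)) h3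
          rw [sj_sj] at this
          rw [← this]; simp only [sj]; split_ifs <;> omega
        have e2 : Q1 = j := by
          have := congrArg (sj (j + 1)) h4
          rw [sj_sj] at this
          rw [← this]; simp only [sj]; split_ifs <;> omega
        have := c1.2.2.2 (j + 1) (by omega) (by omega)
        rw [e1] at this
        have := hU.1
        omega
      · omega
    have hV : 0 < run W (pre0 ++ [c]) c := by
      rw [run_append]
      simp only [run, swW]
      have : sj c c = c + 1 := by simp [sj]
      rw [this]; exact hU.2
    obtain ⟨r, hr, hr'⟩ := least_pos (V := run W (pre0 ++ [c])) (j := j + 1) (t := c) (by omega) hV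
    refine ⟨r, hr, by omega, ?_⟩
    intro d hd
    rw [List.pairwise_append] at hpw
    rw [List.mem_append] at hd
    rcases hd with hd | hd
    · have := hpw.2.2 d hd c (by simp); omega
    · simp at hd; omega

theorem headI_eq {C : Finset (ℤ × ℤ)} {q : ℤ × ℤ} (hq : q ∈ C)
    (h : ∀ c ∈ C, ¬ (q.2 < c.2 ∨ (q.2 = c.2 ∧ c.1 < q.1))) : (C.sort rcOrder).headI = q := by
  have hp := sort_pw C
  have hm : ∀ c, c ∈ C.sort rcOrder ↔ c ∈ C := fun c => Finset.mem_sort _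
  generalize C.sort rcOrder = L at hp hm
  cases L with
  | nil => have := (hm q).2 hq; simp at this
  | cons a L =>
    simp only [List.headI]
    have h1 := (hm q).2 hq
    rw [List.mem_cons] at h1
    rcases h1 with h1 | h1
    · exact h1.symm
    · exact absurd ((List.pairwise_cons.1 hp).1 q h1) (h a ((hm a).1 (by simp)))

theorem open_least {n : ℕ} {R : Finset (ℤ × ℤ)} (hR : Gr n R) {k : ℕ} {L : ℤ → Prop} {r : ℤ}
    (hrk : r ≤ k + 1) (hr : r - 1 ∉ rl n R (k + 1)) (hW : wd (rl n R) k (r - 1) ≤ 0)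
    (hV : 0 < run (wd (rl n R) k) ((rl n R (k + 1)).filter (fun c => r - 1 < c)) r) (hL : L (r - 1))
    (h : ∀ c, c < r - 1 → L c → (∀ d ∈ rl n R (k + 1), c < d → r ≤ d) ∧
      run (wd (rl n R) k) ((rl n R (k + 1)).filter (fun c => r - 1 < c)) (c + 1) ≤ 0) :
    sInf {x : ℤ | L (x - n + k) ∧ OpenSpace n R x ((k : ℤ) + 1)} = r - 1 + n - k := by
  apply IsLeast.csInf_eq
  constructor
  · refine ⟨?_, ?_, ?_, ?_, ?_⟩
    · convert hL using 1; ring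
    · omega
    · rw [mem_rl']; exact hr
    · rw [(lab_main hR k).1 _ (by omega)]; exact hW
    · rw [(lab_main hR k).2 _ (by omega), sub_add_cancel]; exact hV
  · rintro x ⟨hx, h1, h2, h3, h4⟩
    by_contra hlt
    obtain ⟨c, rfl⟩ : ∃ c : ℤ, x = c + n - k := ⟨x - n + k, by ring⟩
    rw [show c + (n : ℤ) - k - n + k = c by ring] at hx
    obtain ⟨a1, a2⟩ := h c (by omega) hx
    rw [(lab_main hR k).2 _ (by omega)] at h4
    rw [show (rl n R (k + 1)).filter (fun d => c < d) = (rl n R (k + 1)).filter (fun c => r - 1 < c) from ?_] at h4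
    · omega
    · apply List.filter_congr
      intro d hd
      have := a1 d hd
      simp only [decide_eq_decide]
      constructor
      · intro h; have := this h; omega
      · intro h; omega

theorem rl_insert {n : ℕ} {R : Finset (ℤ × ℤ)} {k : ℕ} {a : ℤ} {pre post : List ℤ}
    (h : rl n R (k + 1) = pre ++ post) (hpre : ∀ c ∈ pre, a < c) (hpost : ∀ c ∈ post, c < a) :
    rl n (insert (a + (n : ℤ) - k, (k : ℤ) + 1) R) (k + 1) = pre ++ a :: post := by
  have hpw := rl_pw n R (k + 1)
  rw [h, List.pairwise_append] at hpw
  apply rl_eq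
  · rw [List.pairwise_append, List.pairwise_cons]
    refine ⟨hpw.1, ⟨hpost, hpw.2.1⟩, ?_⟩
    intro c hc d hd
    rcases List.mem_cons.1 hd with rfl | hd
    · exact hpre c hc
    · exact hpw.2.2 c hc d hd
  · intro j
    have := mem_rl (n := n) (R := R) (k := k + 1) (j := j)
    rw [h] at this
    rw [Finset.mem_insert, ← this]
    simp only [List.mem_append, List.mem_cons, Prod.mk.injEq]
    push_cast
    constructor
    · rintro (h | rfl | h)
      · simp [h]
      · left; constructor <;> ring
      · simp [h]
    · rintro (⟨h, -⟩ | h)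
      · right; left; omega
      · tauto

theorem rl_insert_ne {n : ℕ} {R : Finset (ℤ × ℤ)} {k i : ℕ} {a : ℤ} (h : i ≠ k + 1) :
    rl n (insert (a, (k : ℤ) + 1) R) i = rl n R i := by
  apply rl_eq (rl_pw _ _ _)
  intro j
  rw [mem_rl, Finset.mem_insert]
  simp only [Prod.mk.injEq]
  constructor
  · exact Or.inr
  · rintro (h' | h')
    · omega
    · exact h'

theorem rl_erase_ne {n : ℕ} {R : Finset (ℤ × ℤ)} {k i : ℕ} {a : ℤ} (h : i ≠ k + 1) :
    rl n (R.erase (a, (k : ℤ) + 1)) i = rl n R i := by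
  apply rl_eq (rl_pw _ _ _)
  intro j
  rw [mem_rl, Finset.mem_erase]
  simp only [ne_eq, Prod.mk.injEq]
  constructor
  · exact fun h' => ⟨by omega, h'⟩
  · exact fun h' => h'.2

theorem rl_erase {n : ℕ} {R : Finset (ℤ × ℤ)} {k : ℕ} {a : ℤ} {pre post : List ℤ}
    (h : rl n R (k + 1) = pre ++ a :: post) :
    rl n (R.erase (a + (n : ℤ) - k, (k : ℤ) + 1)) (k + 1) = pre ++ post := by
  have hpw := rl_pw n R (k + 1)
  rw [h, List.pairwise_append, List.pairwise_cons] at hpw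
  obtain ⟨p1, ⟨p2, p3⟩, p4⟩ := hpw
  apply rl_eq
  · rw [List.pairwise_append]
    exact ⟨p1, p3, fun c hc d hd => p4 c hc d (by simp [hd])⟩
  · intro j
    have := mem_rl (n := n) (R := R) (k := k + 1) (j := j)
    rw [h] at this
    rw [Finset.mem_erase, ← this]
    simp only [List.mem_append, List.mem_cons, Prod.mk.injEq, ne_eq]
    push_cast
    constructor
    · rintro (h | h)
      · have := p4 j h a (by simp)
        exact ⟨by omega, Or.inl h⟩
      · have := p2 j h
        exact ⟨by omega, Or.inr (Or.inr h)⟩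
    · rintro ⟨h1, h | rfl | h⟩
      · exact Or.inl h
      · exact absurd ⟨by ring, rfl⟩ h1
      · exact Or.inr h

theorem split_facts {l pre post : List ℤ} {j : ℤ} (hl : l.Pairwise (· > ·)) (h : l = pre ++ j :: post) :
    (∀ c ∈ pre, j < c) ∧ (∀ c ∈ post, c < j) ∧ (pre.Pairwise (· > ·)) ∧ (post.Pairwise (· > ·)) ∧
    l.filter (fun c => j < c) = pre := by
  subst h
  rw [List.pairwise_append, List.pairwise_cons] at hl
  obtain ⟨p1, ⟨p2, p3⟩, p4⟩ := hl
  refine ⟨fun c hc => p4 c hc j (by simp), p2, p1, p3, ?_⟩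
  rw [List.filter_append, List.filter_cons]
  simp only [lt_irrefl, decide_false]
  rw [List.filter_eq_self.2 (fun c hc => by simpa using p4 c hc j (by simp)),
    List.filter_eq_nil_iff.2 (fun c hc => by have := p2 c hc; simp; omega)]
  simp


theorem later_core {V : ℤ → ℤ} {A B c : ℤ} {l a b : List ℤ} (hV : Function.Injective V) (hB : B ≤ 0) (hA : 0 < A)
    (hI : Invd V A B) (hl : Asc V l) (h : l = a ++ c :: b)
    (hc : (run V a (c + 1) = A ∧ run V a c = B) ∨ (run V a (c + 1) = B ∧ run V a c = A)) : False := by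
  subst h
  rw [Asc_append] at hl
  have hU : Up (run V a) c := hl.2.1
  rcases hc with ⟨h1, h2⟩ | ⟨h1, h2⟩
  · exact Invd_no (run_inj hV a) (Invd_run (by omega) hl.1.ascO hI) h1 h2
  · have := hU.1; omega

theorem wd_tau {f g : ℕ → List ℤ} {k : ℕ} {τ : ℤ → ℤ} (h : wd g k = τ ∘ wd f k) (hfg : ∀ i, k < i → g i = f i) :
    ∀ m, k ≤ m → wd g m = τ ∘ wd f m := by
  intro m hm
  induction m, hm using Nat.le_induction with
  | base => exact h
  | succ m hm ih => rw [wd, ih, hfg _ (by omega), run_comp]; rfl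

theorem Invd_wd {f : ℕ → List ℤ} (hG : Good f) {A B : ℤ} (hAB : B < A) {k : ℕ} (h : Invd (wd f k) A B) :
    ∀ m, k ≤ m → Invd (wd f m) A B := by
  intro m hm
  induction m, hm using Nat.le_induction with
  | base => exact h
  | succ m hm ih => exact Invd_run hAB (hG m).ascO ih

theorem no_later {n : ℕ} {R0 Rc : Finset (ℤ × ℤ)} {k : ℕ} {P Q j : ℤ} {pre post : List ℤ}
    (hG : Good (rl n R0)) (hRc : Gr n Rc)
    (hrow : ∀ i, k < i → rl n Rc i = rl n R0 i) (hC : Cov (wd (rl n R0) k) P Q)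
    (hwd : wd (rl n Rc) k = mvW (wd (rl n R0) k) P Q)
    (hl : rl n R0 (k + 1) = pre ++ j :: post)
    (h1 : run (wd (rl n R0) k) pre (j + 1) = wd (rl n R0) k P)
    (h2 : run (wd (rl n R0) k) pre j = wd (rl n R0) k Q)
    (m : ℕ) (c : ℤ) (hm : c ∈ rl n Rc (m + 1)) (hlate : k < m ∨ (m = k ∧ c < j))
    (hlab : (lab n Rc true (c + n - m) (m + 1) = wd (rl n R0) k P ∧
        lab n Rc false (c + n - m) (m + 1) = wd (rl n R0) k Q) ∨
      (lab n Rc true (c + n - m) (m + 1) = wd (rl n R0) k Q ∧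
        lab n Rc false (c + n - m) (m + 1) = wd (rl n R0) k P)) : False := by
  have hcm : c ≤ m := by have := rl_lt hRc hm; push_cast at this; omega
  have hkm : k ≤ m := by omega
  have hA : 0 < wd (rl n R0) k P := hC.2.1
  have hB : wd (rl n R0) k Q ≤ 0 := hC.2.2.1
  set τ : ℤ → ℤ := fun t => Equiv.swap (wd (rl n R0) k P) (wd (rl n R0) k Q) t with hτ
  have hτ0 : wd (rl n Rc) k = τ ∘ wd (rl n R0) k := by
    rw [hwd, mv_tau (wd_inj _ _)]
  have hτm := wd_tau hτ0 hrow m hkm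
  rw [(lab_main hRc m).1 c hcm, (lab_main hRc m).2 c hcm] at hlab
  rw [hrow _ (by omega)] at hlab hm
  set A := wd (rl n R0) k P with hAd
  set B := wd (rl n R0) k Q with hBd
  have hfl : run (wd (rl n R0) m) ((rl n R0 (m + 1)).filter (fun d => c < d)) c = wd (rl n R0) m c :=
    run_lo (fun d hd => by simp at hd; exact hd.2)
  rw [hτm, run_comp] at hlab
  simp only [Function.comp] at hlab
  rw [← hfl] at hlab
  have t1 : ∀ x, τ x = A → x = B := fun x hx => by
    have := congrArg (Equiv.swap A B) hx
    simpa [hτ] using this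
  have t2 : ∀ x, τ x = B → x = A := fun x hx => by
    have := congrArg (Equiv.swap A B) hx
    simpa [hτ] using this
  have hlab' : (run (wd (rl n R0) m) ((rl n R0 (m + 1)).filter (fun d => c < d)) (c + 1) = A ∧
      run (wd (rl n R0) m) ((rl n R0 (m + 1)).filter (fun d => c < d)) c = B) ∨
      (run (wd (rl n R0) m) ((rl n R0 (m + 1)).filter (fun d => c < d)) (c + 1) = B ∧
      run (wd (rl n R0) m) ((rl n R0 (m + 1)).filter (fun d => c < d)) c = A) := by
    rcases hlab with ⟨a, b⟩ | ⟨a, b⟩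
    · exact Or.inr ⟨t1 _ a, t2 _ b⟩
    · exact Or.inl ⟨t2 _ a, t1 _ b⟩
  have hGk := hG k
  rw [hl, Asc_append] at hGk
  have hI0 : Invd (swW (run (wd (rl n R0) k) pre) j) A B := by
    refine ⟨j, j + 1, by omega, ?_, ?_⟩
    · simp only [swW, sj, if_true]; exact h1
    · simp only [swW, sj]; rw [if_neg (by omega), if_pos trivial]; exact h2
  rcases hlate with hlt | ⟨rfl, hcj⟩
  · have hI1 : Invd (wd (rl n R0) (k + 1)) A B := by
      rw [wd, hl, run_append]
      simp only [run]
      exact Invd_run (by omega) hGk.2.2.ascO hI0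
    have hI := Invd_wd hG (by omega) hI1 m (by omega)
    exact later_core (wd_inj _ _) hB hA hI (hG m) (dec_mem (rl_pw _ _ _) hm) hlab'
  · obtain ⟨s1, s2, s3, s4, s5⟩ := split_facts (rl_pw _ _ _) hl
    have hcp : c ∈ post := by
      rw [hl, List.mem_append, List.mem_cons] at hm
      rcases hm with hm | hm | hm
      · have := s1 c hm; omega
      · omega
      · exact hm
    have hf : (rl n R0 (m + 1)).filter (fun d => c < d) = pre ++ j :: post.filter (fun d => c < d) := by
      rw [hl, List.filter_append, List.filter_cons_of_pos (by simpa using hcj),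
        List.filter_eq_self.2 (fun d hd => by have := s1 d hd; simp; omega)]
    rw [hf, run_append] at hlab'
    exact later_core (swW_inj (run_inj (wd_inj _ _) _) _) hB hA hI0 hGk.2.2 (dec_mem s4 hcp) hlab'

theorem conf_step {n : ℕ} {R0 Rc : Finset (ℤ × ℤ)} {k : ℕ} {P Q j : ℤ} {pre post : List ℤ} {p : ℤ × ℤ}
    (hR0 : Gr n R0) (hG : Good (rl n R0)) (hRc : Gr n Rc) (hkn : k + 1 ≤ n)
    (hrow : ∀ i, k < i → rl n Rc i = rl n R0 i) (hC : Cov (wd (rl n R0) k) P Q)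
    (hwd : wd (rl n Rc) k = mvW (wd (rl n R0) k) P Q)
    (hl : rl n R0 (k + 1) = pre ++ j :: post)
    (h1 : run (wd (rl n R0) k) pre (j + 1) = wd (rl n R0) k P)
    (h2 : run (wd (rl n R0) k) pre j = wd (rl n R0) k Q)
    (hT : Tr (wd (rl n R0) k) P Q pre pre (j + 1) j)
    (hp : p.2 ≤ k) (hPk : P ≤ k)
    (hlA : lab n Rc true p.1 p.2 = wd (rl n R0) k P) (hlB : lab n Rc false p.1 p.2 = wd (rl n R0) k Q) :
    ∃ r, LL (run (wd (rl n R0) k) pre) (j + 1) r ∧ r ≤ k + 1 ∧ ∃ R2, Gr n R2 ∧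
      (∀ fuel, insertSteps n (fuel + 1) Rc p = (Rc, p) :: insertSteps n fuel R2 (r - 1 + n - k, (k : ℤ) + 1)) ∧
      rl n R2 (k + 1) = pre ++ (r - 1) :: post ∧ (∀ i, i ≠ k + 1 → rl n R2 i = rl n Rc i) ∧
      Tr (wd (rl n R0) k) P Q (rl n R0 (k + 1)) (rl n R2 (k + 1)) r (r - 1) ∧
      lab n R2 true (r - 1 + n - k) ((k : ℤ) + 1) = wd (rl n R0) (k + 1) r ∧
      lab n R2 false (r - 1 + n - k) ((k : ℤ) + 1) = wd (rl n R0) (k + 1) (r - 1) := by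
  obtain ⟨s1, s2, s3, s4, s5⟩ := split_facts (rl_pw _ _ _) hl
  have hmem : ∀ c ∈ rl n R0 (k + 1), c ≤ k := fun c hc => by
    have := rl_lt hR0 hc; push_cast at this; omega
  have hGk := hG k
  rw [hl, Asc_append] at hGk
  obtain ⟨r, hr, hrk, hrc⟩ := LL_exists (k := k) hC hGk.1
    (by rw [wd_hi hR0 k _ (by omega)]; omega) hPk s3
    (fun c hc => ⟨s1 c hc, hmem c (by rw [hl]; simp [hc])⟩) hT
  obtain ⟨C1, -, C3⟩ := Tr_single hC hGk.1 hT
  have hVp : run (wd (rl n Rc) k) pre = swW (run (wd (rl n R0) k) pre) j := by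
    rw [hwd, C3, mv_adj']
  have hA : 0 < wd (rl n R0) k P := hC.2.1
  have hB : wd (rl n R0) k Q ≤ 0 := hC.2.2.1
  have hlc : rl n Rc (k + 1) = pre ++ j :: post := by rw [hrow _ (by omega), hl]
  have hVj : run (wd (rl n Rc) k) pre j = wd (rl n R0) k P := by
    rw [hVp]; simp only [swW, sj, if_true]; exact h1
  have hVj1 : run (wd (rl n Rc) k) pre (j + 1) = wd (rl n R0) k Q := by
    rw [hVp]; simp only [swW, sj]; rw [if_neg (by omega), if_pos trivial]; exact h2
  have hVt : ∀ t, j + 1 < t → run (wd (rl n Rc) k) pre t = run (wd (rl n R0) k) pre t := by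
    intro t ht
    rw [hVp, swW, sj_far (by omega) (by omega)]
  have hr1 : j + 1 < r := hr.1
  set q : ℤ × ℤ := (j + (n : ℤ) - k, (k : ℤ) + 1) with hq
  have hjk : j ≤ k := hmem j (by rw [hl]; simp)
  have hlqt : lab n Rc true q.1 q.2 = wd (rl n R0) k Q := by
    simp only [hq]
    rw [(lab_main hRc k).2 j hjk, (split_facts (rl_pw _ _ _) hlc).2.2.2.2]
    exact hVj1
  have hlqf : lab n Rc false q.1 q.2 = wd (rl n R0) k P := by
    simp only [hq]
    rw [(lab_main hRc k).1 j hjk, ← hVj]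
    exact (run_lo s1).symm
  have hqR : q ∈ Rc := mem_rl'.2 (by rw [hlc]; simp)
  have hnRC : ¬ IsRC n Rc := by
    intro h
    have := (IsRC_iff hRc).1 h k
    rw [hlc, AscO_append] at this
    have := this.2.1
    omega
  have hhead : ((Rc.filter fun q =>
            q ≠ p ∧ ((lab n Rc true q.1 q.2 = lab n Rc true p.1 p.2 ∧ lab n Rc false q.1 q.2 = lab n Rc false p.1 p.2) ∨
                     (lab n Rc true q.1 q.2 = lab n Rc false p.1 p.2 ∧ lab n Rc false q.1 q.2 = lab n Rc true p.1 p.2))).sort rcOrder).headI = q := by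
    apply headI_eq
    · rw [Finset.mem_filter]
      refine ⟨hqR, ?_, Or.inr ⟨by rw [hlqt, hlB], by rw [hlqf, hlA]⟩⟩
      intro h
      have : q.2 = p.2 := by rw [h]
      simp only [hq] at this
      omega
    · rintro ⟨a, b⟩ hc hlate
      rw [Finset.mem_filter] at hc
      obtain ⟨hc1, -, hc3⟩ := hc
      simp only [hq] at hlate
      rw [hlA, hlB] at hc3
      simp only at hc3
      obtain ⟨m, rfl⟩ : ∃ m : ℕ, b = (m : ℤ) + 1 := ⟨(b - 1).toNat, by omega⟩
      obtain ⟨c, rfl⟩ : ∃ c : ℤ, a = c + n - m := ⟨a - n + m, by ring⟩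
      exact no_later hG hRc hrow hC hwd hl h1 h2 m c (mem_rl'.1 hc1) (by omega) hc3
  have hRe : Gr n (Rc.erase q) := fun x hx => hRc x (Finset.mem_of_mem_erase hx)
  have hre : rl n (Rc.erase q) (k + 1) = pre ++ post := rl_erase hlc
  have hrene : ∀ i, i ≠ k + 1 → rl n (Rc.erase q) i = rl n Rc i := fun i hi => rl_erase_ne hi
  have hwe : wd (rl n (Rc.erase q)) k = wd (rl n Rc) k :=
    wd_congr (z := k + 1) (fun i hi => hrene i (by omega)) k (by omega)
  have hfilt : (pre ++ post).filter (fun c => r - 1 < c) = pre := by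
    rw [List.filter_append, List.filter_eq_self.2 (fun c hc => by have := hrc c hc; simp; omega),
      List.filter_eq_nil_iff.2 (fun c hc => by have := s2 c hc; simp; omega), List.append_nil]
  have hWr : run (wd (rl n Rc) k) pre (r - 1) = wd (rl n Rc) k (r - 1) :=
    run_lo (fun c hc => by have := hrc c hc; omega)
  have hVr1 : run (wd (rl n Rc) k) pre (r - 1) ≤ 0 := by
    by_cases h : r - 1 = j + 1
    · rw [h, hVj1]; exact hB
    · rw [hVt _ (by omega)]; exact hr.2.2 _ (by omega) (by omega)
  have hinf : sInf {x : ℤ | q.1 < x ∧ OpenSpace n (Rc.erase q) x q.2} = r - 1 + n - k := by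
    have := open_least hRe (k := k) (L := fun x => j < x) (r := r) hrk ?_ ?_ ?_ ?_ ?_
    · rw [← this]
      congr 1
      ext x
      simp only [hq, Set.mem_setOf_eq]
      constructor
      · rintro ⟨a, b⟩; exact ⟨by omega, b⟩
      · rintro ⟨a, b⟩; exact ⟨by omega, b⟩
    · rw [hre, List.mem_append]
      rintro (h | h)
      · have := hrc _ h; omega
      · have := s2 _ h; omega
    · rw [hwe, ← hWr]; exact hVr1
    · rw [hre, hfilt, hwe, hVt r hr1]; exact hr.2.1
    · show j < r - 1
      omega
    · intro c hc1 hc2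
      rw [hre, hfilt, hwe]
      constructor
      · intro d hd hcd
        rw [List.mem_append] at hd
        rcases hd with hd | hd
        · exact hrc d hd
        · have := s2 d hd; omega
      · rw [hVt _ (by omega)]; exact hr.2.2 _ (by omega) (by omega)
  have hrow2 : rl n (insert (r - 1 + (n : ℤ) - k, (k : ℤ) + 1) (Rc.erase q)) (k + 1) = pre ++ (r - 1) :: post :=
    rl_insert hre (fun c hc => by have := hrc c hc; omega) (fun c hc => by have := s2 c hc; omega)
  have hrow2ne : ∀ i, i ≠ k + 1 → rl n (insert (r - 1 + (n : ℤ) - k, (k : ℤ) + 1) (Rc.erase q)) i = rl n Rc i :=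
    fun i hi => by rw [rl_insert_ne hi, hrene i hi]
  have hR2 : Gr n (insert (r - 1 + (n : ℤ) - k, (k : ℤ) + 1) (Rc.erase q)) := by
    intro x hx
    rw [Finset.mem_insert] at hx
    rcases hx with rfl | hx
    · refine ⟨?_, ?_, ?_⟩ <;> simp only <;> omega
    · exact hRe x hx
  have hw2 : wd (rl n (insert (r - 1 + (n : ℤ) - k, (k : ℤ) + 1) (Rc.erase q))) k = wd (rl n Rc) k :=
    wd_congr (z := k + 1) (fun i hi => hrow2ne i (by omega)) k (by omega)
  have hfin : ∀ t, j < t → wd (rl n R0) (k + 1) t = run (wd (rl n Rc) k) pre t := by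
    intro t ht
    rw [wd, hl, run_append, hVp]
    simp only [run]
    exact run_hi (fun c hc => by have := s2 c hc; omega)
  refine ⟨r, hr, hrk, _, hR2, ?_, hrow2, hrow2ne, ?_, ?_, ?_⟩
  · intro fuel
    rw [insertSteps, if_neg hnRC]
    simp only [hhead]
    rw [hinf]
  · rw [hrow2, hl]
    refine Tr_append' hT ⟨r - 1, post, r, r - 1, rfl, Or.inr ⟨rfl, rfl, hr, rfl, rfl⟩, ?_⟩
    have : ∀ (l : List ℤ) (V : ℤ → ℤ), (∀ c ∈ l, c < j) → Tr V r (r - 1) l l r (r - 1) := by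
      intro l
      induction l with
      | nil => intro V _; exact ⟨rfl, rfl, rfl⟩
      | cons a l ih =>
        intro V h
        have ha := h a (by simp)
        refine ⟨a, l, r, r - 1, rfl, Or.inl ⟨by omega, rfl, ?_, ?_⟩, ih _ (fun c hc => h c (by simp [hc]))⟩
        · rw [sj_far (by omega) (by omega)]
        · rw [sj_far (by omega) (by omega)]
    exact this post _ s2
  · rw [(lab_main hR2 k).2 _ (by omega), sub_add_cancel, hw2, hfin r (by omega),
      (split_facts (rl_pw _ _ _) hrow2).2.2.2.2]
  · rw [(lab_main hR2 k).1 _ (by omega), hw2, hfin _ (by omega), hWr]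


theorem state_main {n : ℕ} {R0 : Finset (ℤ × ℤ)} (hR0 : Gr n R0) (hG : Good (rl n R0)) (d : ℕ) :
    ∀ (k : ℕ) (Rc : Finset (ℤ × ℤ)) (P Q : ℤ) (p : ℤ × ℤ) (fuel : ℕ), k + d = n → Gr n Rc →
    (∀ i, k < i → rl n Rc i = rl n R0 i) → (∀ i, i < k → Asc (wd (rl n Rc) i) (rl n Rc (i + 1))) →
    Cov (wd (rl n R0) k) P Q → wd (rl n Rc) k = mvW (wd (rl n R0) k) P Q →
    p.2 ≤ k → P ≤ k → lab n Rc true p.1 p.2 = wd (rl n R0) k P →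
    lab n Rc false p.1 p.2 = wd (rl n R0) k Q → d + 1 ≤ fuel →
    ∃ R' p', (insertSteps n fuel Rc p).getLast? = some (R', p') ∧ Gr n R' ∧
      (∀ i, i ≤ k → rl n R' i = rl n Rc i) ∧ ∃ P' Q' : ℕ → ℤ, P' k = P ∧ Q' k = Q ∧
      ∀ i, k ≤ i → Tr (wd (rl n R0) i) (P' i) (Q' i) (rl n R0 (i + 1)) (rl n R' (i + 1))
        (P' (i + 1)) (Q' (i + 1)) := by
  induction d with
  | zero =>
    intro k Rc P Q p fuel hk hRc hrow hasc hC hwd hp hPk hlA hlB hf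
    obtain ⟨fuel, rfl⟩ : ∃ f, fuel = f + 1 := ⟨fuel - 1, by omega⟩
    have hRC : IsRC n Rc := by
      rw [IsRC_iff hRc]
      intro i
      by_cases h : i < k
      · exact (hasc i h).ascO
      · rw [rl_big hRc (by omega)]; trivial
    refine ⟨Rc, p, ?_, hRc, fun _ _ => rfl, fun _ => P, fun _ => Q, rfl, rfl, ?_⟩
    · rw [insertSteps, if_pos hRC]; rfl
    · intro i hi
      rw [rl_big hRc (by omega), rl_big hR0 (by omega)]
      exact ⟨rfl, rfl, rfl⟩
  | succ d ih =>
    intro k Rc P Q p fuel hk hRc hrow hasc hC hwd hp hPk hlA hlB hf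
    rcases Tr_dich (W := wd (rl n R0) k) (P := P) (Q := Q) (rl n R0 (k + 1)) with
      ⟨P1, Q1, hT, h1, h2⟩ | ⟨pre, j, post, hl, hT, h1, h2⟩
    · obtain ⟨C1, C2, C3⟩ := Tr_single hC (hG k) hT
      have hr1 := hrow (k + 1) (by omega)
      have hP1 : P1 ≤ ((k + 1 : ℕ) : ℤ) := by
        by_contra h
        push_cast at h
        have e1 : wd (rl n R0) (k + 1) P1 = P1 := wd_hi hR0 _ _ (by push_cast; omega)
        have e2 : wd (rl n R0) k P1 = P1 := wd_hi hR0 _ _ (by omega)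
        have e3 : wd (rl n R0) (k + 1) P1 = wd (rl n R0) k P := h1
        have := wd_inj _ _ (e2.trans (e1.symm.trans e3))
        omega
      obtain ⟨R', p', g1, g2, g3, P', Q', g4, g5, g6⟩ := ih (k + 1) Rc P1 Q1 p fuel (by omega) hRc
        (fun i hi => hrow i (by omega))
        (fun i hi => by
          by_cases h : i < k
          · exact hasc i h
          · have : i = k := by omega
            subst this
            rw [hr1, hwd]; exact C2)
        C1 (by rw [wd, hwd, hr1, C3]; rfl) (by push_cast; omega) hP1
        (hlA.trans h1.symm) (hlB.trans h2.symm) (by omega)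
      refine ⟨R', p', g1, g2, fun i hi => g3 i (by omega), fun i => if i = k then P else P' i,
        fun i => if i = k then Q else Q' i, if_pos rfl, if_pos rfl, ?_⟩
      intro i hi
      rcases Nat.eq_or_lt_of_le hi with rfl | hi
      · simp only [if_true]
        rw [if_neg (by omega), if_neg (by omega), g4, g5, g3 _ le_rfl, hr1]
        exact hT
      · beta_reduce
        rw [if_neg (by omega), if_neg (by omega), if_neg (by omega), if_neg (by omega)]
        exact g6 i hi
    · obtain ⟨r, hr, hrk, R2, hR2, hst, hrow2, hne, hT2, l1, l2⟩ :=
        conf_step hR0 hG hRc (by omega) hrow hC hwd hl h1 h2 hT hp hPk hlA hlB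
      obtain ⟨fuel, rfl⟩ : ∃ f, fuel = f + 1 := ⟨fuel - 1, by omega⟩
      obtain ⟨C1, C2, C3⟩ := Tr_single hC (hG k) hT2
      have hw : ∀ i, i < k + 1 → wd (rl n R2) i = wd (rl n Rc) i :=
        wd_congr (fun i hi => hne i (by omega))
      obtain ⟨R', p', g1, g2, g3, P', Q', g4, g5, g6⟩ := ih (k + 1) R2 r (r - 1)
        (r - 1 + n - k, (k : ℤ) + 1) fuel (by omega) hR2
        (fun i hi => by rw [hne i (by omega)]; exact hrow i (by omega))
        (fun i hi => by
          rw [hw i hi]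
          by_cases h : i < k
          · rw [hne _ (by omega)]; exact hasc i h
          · have : i = k := by omega
            subst this
            rw [hwd]; exact C2)
        C1 (by rw [wd, hw k (by omega), hwd, C3]; rfl) (by push_cast; simp) (by push_cast; exact hrk)
        l1 l2 (by omega)
      refine ⟨R', p', ?_, g2, fun i hi => by rw [g3 i (by omega), hne i (by omega)],
        fun i => if i = k then P else P' i,
        fun i => if i = k then Q else Q' i, if_pos rfl, if_pos rfl, ?_⟩
      · rw [hst, List.getLast?_cons, g1]; rfl
      intro i hi
      rcases Nat.eq_or_lt_of_le hi with rfl | hi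
      · simp only [if_true]
        rw [if_neg (by omega), if_neg (by omega), g4, g5, g3 _ le_rfl]
        exact hT2
      · beta_reduce
        rw [if_neg (by omega), if_neg (by omega), if_neg (by omega), if_neg (by omega)]
        exact g6 i hi

theorem FL_exists {W : ℤ → ℤ} {t : ℤ} (hlow : ∃ N : ℤ, ∀ s, s < N → W s = s) (ht : 0 < W t) :
    ∃ r, FL W r ∧ r ≤ t := by
  obtain ⟨N, hN⟩ := hlow
  obtain ⟨r, hr, hm⟩ := Int.exists_least_of_bdd (P := fun t => 0 < W t) ⟨min N 0, fun z hz => by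
    by_contra h
    have := hN z (by omega)
    omega⟩ ⟨t, ht⟩
  refine ⟨r, ⟨fun s s1 => ?_, hr⟩, hm t ht⟩
  by_contra hc
  have := hm s (by omega)
  omega

theorem FL_row {W : ℤ → ℤ} {k : ℤ} {l : List ℤ} (hA : Asc W l) (hl : l.Pairwise (· > ·))
    (hlk : ∀ c ∈ l, c ≤ k) (hk : 0 < W (k + 1)) (hlow : ∃ N : ℤ, ∀ s, s < N → run W l s = s) :
    ∃ r, FL (run W l) r ∧ r ≤ k + 1 ∧ ∀ c ∈ l, r ≤ c := by
  rcases List.eq_nil_or_concat l with rfl | ⟨l0, c, rfl⟩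
  · obtain ⟨r, h1, h2⟩ := FL_exists hlow hk
    exact ⟨r, h1, h2, by simp⟩
  · rw [List.concat_eq_append] at *
    rw [Asc_append] at hA
    have hU : Up (run W l0) c := hA.2.1
    have hV : 0 < run W (l0 ++ [c]) c := by
      rw [run_append]
      simp only [run, swW]
      have : sj c c = c + 1 := by simp [sj]
      rw [this]; exact hU.2
    obtain ⟨r, h1, h2⟩ := FL_exists hlow hV
    have := hlk c (by simp)
    refine ⟨r, h1, by omega, ?_⟩
    intro d hd
    rw [List.pairwise_append] at hl
    rw [List.mem_append] at hd
    rcases hd with hd | hd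
    · have := hl.2.2 d hd c (by simp); omega
    · simp at hd; omega

theorem insert_main {n : ℕ} {R : Finset (ℤ × ℤ)} (hR : Gr n R) (hG : Good (rl n R)) {k : ℕ} (hk : 0 < k)
    (hkn : k ≤ n) : ∃ P Q, Gr n (insertOne n R k) ∧ Ins (rl n R) k (rl n (insertOne n R k)) P Q := by
  obtain ⟨k, rfl⟩ : ∃ m, k = m + 1 := ⟨k - 1, by omega⟩
  have hmem : ∀ c ∈ rl n R (k + 1), c ≤ k := fun c hc => by
    have := rl_lt hR hc; push_cast at this; omega
  obtain ⟨r, hr, hrk, hrc⟩ := FL_row (k := k) (hG k) (rl_pw _ _ _) hmem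
    (by rw [wd_hi hR k _ (by omega)]; omega) (wd_low (rl n R) (k + 1))
  have hfilt : (rl n R (k + 1)).filter (fun c => r - 1 < c) = rl n R (k + 1) :=
    List.filter_eq_self.2 (fun c hc => by have := hrc c hc; simp; omega)
  have hWr : run (wd (rl n R) k) (rl n R (k + 1)) (r - 1) = wd (rl n R) k (r - 1) :=
    run_lo (fun c hc => by have := hrc c hc; omega)
  have hinf : sInf {x : ℤ | OpenSpace n R x ((k : ℤ) + 1)} = r - 1 + n - k := by
    have := open_least hR (k := k) (L := fun _ => True) (r := r) hrk ?_ ?_ ?_ trivial ?_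
    · simpa using this
    · intro h; have := hrc _ h; omega
    · rw [← hWr]; exact hr.1 _ (by omega)
    · rw [hfilt]; exact hr.2
    · intro c hc _
      rw [hfilt]
      exact ⟨fun d hd _ => hrc d hd, hr.1 _ (by omega)⟩
  set R1 := insert (r - 1 + (n : ℤ) - k, (k : ℤ) + 1) R with hR1d
  have hrow1 : rl n R1 (k + 1) = rl n R (k + 1) ++ [r - 1] :=
    rl_insert (by simp) (fun c hc => by have := hrc c hc; omega) (by simp)
  have hne : ∀ i, i ≠ k + 1 → rl n R1 i = rl n R i := fun i hi => rl_insert_ne hi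
  have hR1 : Gr n R1 := by
    intro x hx
    rw [hR1d, Finset.mem_insert] at hx
    rcases hx with rfl | hx
    · refine ⟨?_, ?_, ?_⟩ <;> simp only <;> omega
    · exact hR x hx
  have hw : ∀ i, i < k + 1 → wd (rl n R1) i = wd (rl n R) i :=
    wd_congr (fun i hi => hne i (by omega))
  have hUp : Up (wd (rl n R) (k + 1)) (r - 1) := by
    unfold Up
    rw [sub_add_cancel]
    have h1 := hr.1 (r - 1) (by omega)
    have h2 := hr.2
    exact ⟨lt_of_le_of_lt h1 h2, h2⟩
  obtain ⟨R', p', g1, g2, g3, P', Q', g4, g5, g6⟩ := state_main hR hG (n - (k + 1)) (k + 1) R1 r (r - 1)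
    (r - 1 + n - k, (k : ℤ) + 1) (((n : ℤ) + 1 - ((k : ℤ) + 1)).toNat + 1) (by omega) hR1
    (fun i hi => hne i (by omega))
    (fun i hi => by
      rw [hw i hi]
      by_cases h : i = k
      · subst h
        rw [hrow1, Asc_append]
        exact ⟨hG i, hUp, trivial⟩
      · rw [hne _ (by omega)]; exact hG i)
    ⟨by omega, hr.2, hr.1 _ (by omega), fun t _ _ => by omega⟩
    (by
      rw [wd, hw k (by omega), hrow1, run_append]
      have := mv_adj' (wd (rl n R) (k + 1)) (r - 1)
      rw [sub_add_cancel] at this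
      rw [this]; rfl)
    (by push_cast; simp) (by push_cast; exact hrk)
    (by
      simp only
      rw [(lab_main hR1 k).2 _ (by omega), sub_add_cancel, hw k (by omega),
        (split_facts (post := []) (rl_pw _ _ _) hrow1).2.2.2.2]
      rfl)
    (by
      simp only
      rw [(lab_main hR1 k).1 _ (by omega), hw k (by omega), ← hWr]
      rfl)
    (by omega)
  have hone : insertOne n R ((k + 1 : ℕ) : ℤ) = R' := by
    unfold insertOne insertStepsOf
    push_cast
    simp only [hinf]
    rw [← hR1d, g1]; rfl
  rw [hone]
  refine ⟨P', Q', g2, ?_, ?_, ?_, ?_, g6⟩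
  · intro i hi
    rw [g3 i (by omega), hne i (by omega)]
  · rw [g4]; exact hr
  · rw [g4, g5]
  · rw [g3 _ le_rfl, g4, hrow1]


/-- For every rc-graph `R` satisfying (*) and `0 < x ≤ y < z ≤ n`,
`R ← xzy = R ← zxy`. -/
theorem insert_xzy_eq_zxy (n : ℕ) (hn : 0 < n) (R : Finset (ℤ × ℤ))
    (hR : IsRC n R) (hS : Star n R) (x y z : ℕ)
    (hx : 0 < x) (hxy : x ≤ y) (hyz : y < z) (hzn : z ≤ n) :
    insertWord n R [x, z, y] = insertWord n R [z, x, y] := by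
  obtain ⟨h0, hG⟩ := star_good hR hS
  have hy : 0 < y := by omega
  have hz : 0 < z := by omega
  obtain ⟨_, _, a1, A⟩ := insert_main h0 hG hx (by omega)
  obtain ⟨_, _, b1, B⟩ := insert_main a1 (A.good hx hG) hz hzn
  obtain ⟨_, _, c1, C⟩ := insert_main b1 (B.good hz (A.good hx hG)) hy (by omega)
  obtain ⟨_, _, a2, A'⟩ := insert_main h0 hG hz hzn
  obtain ⟨_, _, b2, B'⟩ := insert_main a2 (A'.good hz hG) hx (by omega)
  obtain ⟨_, _, c2, C'⟩ := insert_main b2 (B'.good hx (A'.good hz hG)) hy (by omega)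
  simp only [insertWord, List.foldl_cons, List.foldl_nil]
  exact Gr.ext c1 c2 (rows_main hx hxy hyz hG A B C A' B' C')
end RCGraphs
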